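/- arXiv:2412.15116 — 5 statements merged into one kernel-verified Lean document; each statement's English description precedes it below -/
import Mathlib

section
/- Fix real parameters α > 0 and β > 0 and an index i ≥ 1. Let λ = (λ_1 ≥ λ_2 ≥ …) be a random partition sampled from the mixed measure M^(α,β). Then the distribution of λ_i is log-concave on ℕ: for every integer k ≥ 1, P(λ_i = k)² ≥ P(λ_i = k−1) · P(λ_i = k+1), and the support {k : P(λ_i = k) > 0} is an interval of integers. -/
open scoped BigOperators

noncomputable section

/-- The number of standard Young tableaux of shape `μ`: semistandard tableaux whose
entries on the cells are exactly `0, 1, …, μ.card - 1`, each appearing once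
(distinct entries make the rows strictly increasing as well). -/
def sytCard (μ : YoungDiagram) : ℕ :=
  Nat.card {T : SemistandardYoungTableau μ //
    (∀ c ∈ μ.cells, T c.1 c.2 < μ.card) ∧
    Set.InjOn (fun c : ℕ × ℕ => T c.1 c.2) ↑μ.cells}

/-- Unnormalized weight of a partition `λ` under the mixed measure `M^(α,β)`:
`α^{|λ|} · (d_λ / |λ|!)^β`. -/
def mixedWeight (α β : ℝ) (μ : YoungDiagram) : ℝ :=
  α ^ μ.card * ((sytCard μ : ℝ) / (Nat.factorial μ.card : ℝ)) ^ β

/-- `M^(α,β)(λ)`, the mixture over `X ~ ν_{α,β}` of the `β`-Plancherel measures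
`μ_X^{(β)}`. -/
def mixedProb (α β : ℝ) (μ : YoungDiagram) : ℝ :=
  mixedWeight α β μ / ∑' τ : YoungDiagram, mixedWeight α β τ

/-- The probability that the `i`-th row (`1`-indexed) of a partition sampled from
`M^(α,β)` has length `k`. -/
def mixedRowProb (α β : ℝ) (i k : ℕ) : ℝ :=
  ∑' μ : {μ : YoungDiagram // μ.rowLen (i - 1) = k}, mixedProb α β μ.1

abbrev SYT (μ : YoungDiagram) : Type := {T : SemistandardYoungTableau μ //
    (∀ c ∈ μ.cells, T c.1 c.2 < μ.card) ∧
    Set.InjOn (fun c : ℕ × ℕ => T c.1 c.2) ↑μ.cells}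

lemma SYT.ext' {μ : YoungDiagram} {T T' : SYT μ} (h : ∀ i j, (i,j) ∈ μ → T.1 i j = T'.1 i j) :
    T = T' := by
  apply Subtype.ext
  apply SemistandardYoungTableau.ext
  intro i j
  by_cases hm : (i,j) ∈ μ
  · exact h i j hm
  · rw [T.1.zeros hm, T'.1.zeros hm]

instance (μ : YoungDiagram) : Finite (SYT μ) := by
  apply Finite.of_injective (β := μ.cells → Fin μ.card)
    (fun T c => ⟨T.1 c.1.1 c.1.2, T.2.1 c.1 c.2⟩)
  intro T T' h
  apply SYT.ext'
  intro i j hm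
  have := congrFun h ⟨(i,j), hm⟩
  simpa using this

def Rem (μ : YoungDiagram) (a : ℕ) : Prop := μ.rowLen (a+1) < μ.rowLen a

def remRow (μ : YoungDiagram) (a : ℕ) : YoungDiagram where
  cells := μ.cells.filter (fun c => ¬(c.1 = a ∧ c.2 + 1 = μ.rowLen a ∧ μ.rowLen (a+1) < μ.rowLen a))
  isLowerSet := by
    rintro ⟨i, j⟩ ⟨i', j'⟩ hle hm
    have h1 : i' ≤ i := hle.1
    have h2 : j' ≤ j := hle.2
    simp only [Finset.coe_filter, Set.mem_ofPred_eq, YoungDiagram.mem_cells,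
      YoungDiagram.mem_iff_lt_rowLen] at hm ⊢
    have h3 := μ.rowLen_anti _ _ h1
    refine ⟨by omega, ?_⟩
    rintro ⟨rfl, h5, h6⟩
    rcases Nat.eq_or_lt_of_le h1 with h | h
    · subst h
      omega
    · have := μ.rowLen_anti (i'+1) i h
      omega

lemma mem_remRow {μ : YoungDiagram} {a : ℕ} (h : Rem μ a) (i j : ℕ) :
    (i, j) ∈ remRow μ a ↔ (i, j) ∈ μ ∧ (i, j) ≠ (a, μ.rowLen a - 1) := by
  have h' : μ.rowLen (a+1) < μ.rowLen a := h
  rw [← YoungDiagram.mem_cells, remRow]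
  simp only [Finset.mem_filter, YoungDiagram.mem_cells, ne_eq, Prod.mk.injEq]
  refine and_congr_right fun _ => not_congr ?_
  refine and_congr_right fun _ => ?_
  omega

lemma corner_mem {μ : YoungDiagram} {a : ℕ} (h : Rem μ a) : (a, μ.rowLen a - 1) ∈ μ := by
  rw [YoungDiagram.mem_iff_lt_rowLen]
  unfold Rem at h
  omega

lemma cells_remRow {μ : YoungDiagram} {a : ℕ} (h : Rem μ a) :
    (remRow μ a).cells = μ.cells.erase (a, μ.rowLen a - 1) := by
  ext ⟨i, j⟩
  rw [YoungDiagram.mem_cells, mem_remRow h, Finset.mem_erase, YoungDiagram.mem_cells, and_comm]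

lemma card_remRow {μ : YoungDiagram} {a : ℕ} (h : Rem μ a) :
    (remRow μ a).card + 1 = μ.card := by
  change (remRow μ a).cells.card + 1 = μ.cells.card
  rw [cells_remRow h]
  exact Finset.card_erase_add_one (corner_mem h)

lemma rowLen_ext {μ : YoungDiagram} {i n : ℕ} (h : ∀ j, (i, j) ∈ μ ↔ j < n) : μ.rowLen i = n := by
  simp only [YoungDiagram.mem_iff_lt_rowLen] at h
  have h1 := h n
  have h2 := h (μ.rowLen i)
  omega

lemma rowLen_remRow {μ : YoungDiagram} {a : ℕ} (h : Rem μ a) (b : ℕ) :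
    (remRow μ a).rowLen b = if b = a then μ.rowLen a - 1 else μ.rowLen b := by
  apply rowLen_ext
  intro j
  rw [mem_remRow h, YoungDiagram.mem_iff_lt_rowLen]
  unfold Rem at h
  simp only [ne_eq, Prod.mk.injEq]
  split_ifs with hb
  · subst hb
    omega
  · simp [hb]

def extendSYT {μ : YoungDiagram} {a : ℕ} (h : Rem μ a) (T : SYT (remRow μ a)) : SYT μ :=
  ⟨{ entry := fun i j => if (i, j) = (a, μ.rowLen a - 1) then (remRow μ a).card else T.1 i j
     row_weak' := by
      intro i j1 j2 hj hm
      have hm1 : (i, j1) ∈ μ := μ.up_left_mem le_rfl hj.le hm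
      have hr : j2 < μ.rowLen i := YoungDiagram.mem_iff_lt_rowLen.1 hm
      by_cases h2 : (i, j2) = (a, μ.rowLen a - 1)
      · simp only [h2, if_true]
        split_ifs with h1
        · exact le_rfl
        · exact (T.2.1 (i, j1) ((mem_remRow h _ _).2 ⟨hm1, h1⟩)).le
      · have h1 : (i, j1) ≠ (a, μ.rowLen a - 1) := by
          intro h1
          simp only [Prod.mk.injEq] at h1 h2
          obtain ⟨rfl, h1⟩ := h1
          omega
        simp only [h1, h2, if_false]
        exact T.1.row_weak hj ((mem_remRow h _ _).2 ⟨hm, h2⟩)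
     col_strict' := by
      intro i1 i2 j hi hm
      have hm1 : (i1, j) ∈ μ := μ.up_left_mem hi.le le_rfl hm
      have hr : j < μ.rowLen i2 := YoungDiagram.mem_iff_lt_rowLen.1 hm
      have h1 : (i1, j) ≠ (a, μ.rowLen a - 1) := by
        intro h1
        simp only [Prod.mk.injEq] at h1
        obtain ⟨rfl, h1⟩ := h1
        have := μ.rowLen_anti (i1+1) i2 hi
        unfold Rem at h
        omega
      simp only [h1, if_false]
      split_ifs with h2
      · exact (T.2.1 (i1, j) ((mem_remRow h _ _).2 ⟨hm1, h1⟩))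
      · exact T.1.col_strict hi ((mem_remRow h _ _).2 ⟨hm, h2⟩)
     zeros' := by
      intro i j hm
      have h1 : (i, j) ≠ (a, μ.rowLen a - 1) := by
        intro h1
        rw [h1] at hm
        exact hm (corner_mem h)
      simp only [h1, if_false]
      exact T.1.zeros (fun hh => hm ((mem_remRow h _ _).1 hh).1) },
    by
      constructor
      · rintro ⟨i, j⟩ hm
        change (if (i, j) = (a, μ.rowLen a - 1) then (remRow μ a).card else T.1 i j) < _
        rw [← card_remRow h]
        split_ifs with h1
        · omega
        · exact (T.2.1 (i, j) ((mem_remRow h _ _).2 ⟨hm, h1⟩)).trans (Nat.lt_succ_self _)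
      · rintro ⟨i, j⟩ hm ⟨i', j'⟩ hm' heq
        change (if (i, j) = (a, μ.rowLen a - 1) then (remRow μ a).card else T.1 i j) =
          (if (i', j') = (a, μ.rowLen a - 1) then (remRow μ a).card else T.1 i' j') at heq
        split_ifs at heq with h1 h2 h2
        · rw [h1, h2]
        · exact absurd heq.symm (T.2.1 (i', j') ((mem_remRow h _ _).2 ⟨hm', h2⟩)).ne
        · exact absurd heq (T.2.1 (i, j) ((mem_remRow h _ _).2 ⟨hm, h1⟩)).ne
        · exact T.2.2 ((mem_remRow h _ _).2 ⟨hm, h1⟩) ((mem_remRow h _ _).2 ⟨hm', h2⟩) heq⟩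

lemma extendSYT_apply {μ : YoungDiagram} {a : ℕ} (h : Rem μ a) (T : SYT (remRow μ a)) (i j : ℕ) :
    (extendSYT h T).1 i j = if (i, j) = (a, μ.rowLen a - 1) then (remRow μ a).card else T.1 i j :=
  rfl

def restrictSYT {μ : YoungDiagram} {a : ℕ} (h : Rem μ a) (T : SYT μ)
    (hT : T.1 a (μ.rowLen a - 1) = (remRow μ a).card) : SYT (remRow μ a) :=
  ⟨{ entry := fun i j => if (i, j) = (a, μ.rowLen a - 1) then 0 else T.1 i j
     row_weak' := by
      intro i j1 j2 hj hm
      obtain ⟨hm, h2⟩ := (mem_remRow h _ _).1 hm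
      simp only [h2, if_false]
      split_ifs
      · exact Nat.zero_le _
      · exact T.1.row_weak hj hm
     col_strict' := by
      intro i1 i2 j hi hm
      obtain ⟨hm, h2⟩ := (mem_remRow h _ _).1 hm
      simp only [h2, if_false]
      split_ifs
      · exact (Nat.zero_le _).trans_lt (T.1.col_strict hi hm)
      · exact T.1.col_strict hi hm
     zeros' := by
      intro i j hm
      rw [mem_remRow h] at hm
      split_ifs with h1
      · rfl
      · exact T.1.zeros (fun hh => hm ⟨hh, h1⟩) },
    by
      constructor
      · rintro ⟨i, j⟩ hm
        obtain ⟨hm, h2⟩ := (mem_remRow h _ _).1 hm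
        change (if (i, j) = (a, μ.rowLen a - 1) then 0 else T.1 i j) < _
        rw [if_neg h2]
        have h3 := T.2.1 (i, j) hm
        have h4 : T.1 i j ≠ T.1 a (μ.rowLen a - 1) := fun h4 => h2 (T.2.2 hm (corner_mem h) h4)
        have := card_remRow h
        simp only at h3
        omega
      · rintro ⟨i, j⟩ hm ⟨i', j'⟩ hm' heq
        obtain ⟨hm, h2⟩ := (mem_remRow h _ _).1 hm
        obtain ⟨hm', h2'⟩ := (mem_remRow h _ _).1 hm'
        change (if (i, j) = (a, μ.rowLen a - 1) then 0 else T.1 i j) =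
          (if (i', j') = (a, μ.rowLen a - 1) then 0 else T.1 i' j') at heq
        rw [if_neg h2, if_neg h2'] at heq
        exact T.2.2 hm hm' heq⟩

lemma restrictSYT_apply {μ : YoungDiagram} {a : ℕ} (h : Rem μ a) (T : SYT μ)
    (hT : T.1 a (μ.rowLen a - 1) = (remRow μ a).card) (i j : ℕ) :
    (restrictSYT h T hT).1 i j = if (i, j) = (a, μ.rowLen a - 1) then 0 else T.1 i j :=
  rfl

lemma exists_max {μ : YoungDiagram} (hμ : 0 < μ.card) (T : SYT μ) :
    ∃ a, Rem μ a ∧ T.1 a (μ.rowLen a - 1) + 1 = μ.card := by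
  have himg : μ.cells.image (fun c : ℕ × ℕ => T.1 c.1 c.2) = Finset.range μ.card := by
    apply Finset.eq_of_subset_of_card_le
    · intro x hx
      obtain ⟨c, hc, rfl⟩ := Finset.mem_image.1 hx
      exact Finset.mem_range.2 (T.2.1 c hc)
    · rw [Finset.card_image_of_injOn T.2.2, Finset.card_range]
  have hmem : μ.card - 1 ∈ μ.cells.image (fun c : ℕ × ℕ => T.1 c.1 c.2) := by
    rw [himg, Finset.mem_range]; omega
  obtain ⟨⟨i, j⟩, hc, hT⟩ := Finset.mem_image.1 hmem
  simp only at hT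
  have hc' := YoungDiagram.mem_iff_lt_rowLen.1 ((YoungDiagram.mem_cells _).1 hc)
  have h1 : (i, j+1) ∉ μ := by
    intro hm
    have h2 := T.1.row_weak (show j < j + 1 by omega) hm
    have h3 := T.2.1 (i, j+1) hm
    simp only at h3
    have h4 : T.1 i j = T.1 i (j+1) := by omega
    have := T.2.2 hc hm h4
    simp at this
  have h2 : (i+1, j) ∉ μ := by
    intro hm
    have h2 := T.1.col_strict (show i < i + 1 by omega) hm
    have h3 := T.2.1 (i+1, j) hm
    simp only at h3
    omega
  rw [YoungDiagram.mem_iff_lt_rowLen] at h1 h2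
  have hj : j = μ.rowLen i - 1 := by omega
  refine ⟨i, ?_, ?_⟩
  · unfold Rem; omega
  · rw [← hj]; omega

open Classical in
lemma sytCard_rec {μ : YoungDiagram} (hμ : 0 < μ.card) (N : ℕ) (hN : μ.rowLen N = 0) :
    sytCard μ = ∑ a : Fin N, if Rem μ a then sytCard (remRow μ a) else 0 := by
  have hb : Function.Bijective (fun p : (Σ a : {a : Fin N // Rem μ a}, SYT (remRow μ a)) =>
      extendSYT p.1.2 p.2) := by
    constructor
    · rintro ⟨⟨a, ha⟩, T⟩ ⟨⟨a', ha'⟩, T'⟩ heq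
      simp only at heq
      have haa : a = a' := by
        have h1 : (extendSYT ha T).1 a (μ.rowLen a - 1) = μ.card - 1 := by
          rw [extendSYT_apply, if_pos rfl, ← card_remRow ha]; rfl
        have h2 : (extendSYT ha' T').1 a' (μ.rowLen a' - 1) = μ.card - 1 := by
          rw [extendSYT_apply, if_pos rfl, ← card_remRow ha']; rfl
        rw [heq] at h1
        have := (extendSYT ha' T').2.2 (corner_mem ha) (corner_mem ha') (h1.trans h2.symm)
        simp only [Prod.mk.injEq] at this
        exact Fin.ext this.1
      subst haa
      have : T = T' := by
        apply SYT.ext'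
        intro i j hm
        have h2 := ((mem_remRow ha _ _).1 hm).2
        have h3 : (extendSYT ha T).1 i j = (extendSYT ha' T').1 i j := by rw [heq]
        rwa [extendSYT_apply, extendSYT_apply, if_neg h2, if_neg h2] at h3
      rw [this]
    · intro T
      obtain ⟨a, ha, hT⟩ := exists_max hμ T
      have haN : a < N := by
        by_contra hc
        have := μ.rowLen_anti N a (not_lt.1 hc)
        unfold Rem at ha
        omega
      have hT' : T.1 a (μ.rowLen a - 1) = (remRow μ a).card := by
        have := card_remRow ha
        omega
      refine ⟨⟨⟨⟨a, haN⟩, ha⟩, restrictSYT ha T hT'⟩, ?_⟩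
      apply SYT.ext'
      intro i j _
      rw [extendSYT_apply, restrictSYT_apply]
      split_ifs with h1
      · simp only [Prod.mk.injEq] at h1
        rw [h1.1, h1.2, hT']
      · rfl
  have := Nat.card_congr (Equiv.ofBijective _ hb)
  rw [Nat.card_sigma] at this
  change Nat.card (SYT μ) = _
  rw [← this, ← Finset.sum_filter, Finset.sum_subtype (p := fun a : Fin N => Rem μ a) _ (by simp)]
  rfl

lemma eq_bot_of_card {μ : YoungDiagram} (h : μ.card = 0) : μ = ⊥ := by
  apply YoungDiagram.ext
  exact Finset.card_eq_zero.1 h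

lemma sytCard_bot {μ : YoungDiagram} (h : μ.card = 0) : sytCard μ = 1 := by
  have hμ := eq_bot_of_card h
  subst hμ
  change Nat.card (SYT ⊥) = 1
  rw [Nat.card_eq_one_iff_unique]
  constructor
  · constructor
    intro T T'
    apply SYT.ext'
    intro i j hm
    exact absurd hm (YoungDiagram.notMem_bot _)
  · refine ⟨⟨⟨fun _ _ => 0, ?_, ?_, ?_⟩, ?_, ?_⟩⟩
    · intros; exact le_rfl
    · intro _ _ _ _ hm; exact absurd hm (YoungDiagram.notMem_bot _)
    · intros; rfl
    · intro c hm; exact absurd hm (YoungDiagram.notMem_bot _)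
    · intro c hm; exact absurd hm (YoungDiagram.notMem_bot _)

open Matrix in
lemma vand_rec (N : ℕ) (v : Fin N → ℝ) :
    ∑ a, v a * (vandermonde (Function.update v a (v a - 1))).det
      = (∑ a, v a - ∑ a : Fin N, ((a : ℕ) : ℝ)) * (vandermonde v).det := by
  have key : ∀ w : Fin N → ℝ, (vandermonde w).det =
      (Matrix.of fun i j : Fin N => (descPochhammer ℝ (j : ℕ)).eval (w i)).det := fun w =>
    det_eval_matrixOfPolynomials_eq_det_vandermonde w (fun j => descPochhammer ℝ (j : ℕ))
      (fun i => descPochhammer_natDegree ℝ i) (fun i => monic_descPochhammer ℝ i)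
  have hT : ∀ (x : ℝ) (j : ℕ), x * (descPochhammer ℝ j).eval (x - 1) =
      (x - j) * (descPochhammer ℝ j).eval x := by
    intro x j
    have h1 := descPochhammer_succ_eval j x
    rw [descPochhammer_succ_left] at h1
    simp only [Polynomial.eval_mul, Polynomial.eval_X, Polynomial.eval_comp,
      Polynomial.eval_sub, Polynomial.eval_one] at h1
    rw [h1]; ring
  simp only [key, det_apply', Matrix.of_apply, Finset.mul_sum]
  rw [Finset.sum_comm]
  refine Finset.sum_congr rfl fun σ _ => ?_
  have h2 : ∑ a, v a - ∑ a : Fin N, ((a : ℕ) : ℝ) = ∑ a, (v a - ((σ⁻¹ a : Fin N) : ℕ)) := by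
    rw [Finset.sum_sub_distrib]
    congr 1
    exact (Equiv.sum_comp σ⁻¹ (fun a : Fin N => ((a : ℕ) : ℝ))).symm
  rw [h2, Finset.sum_mul]
  refine Finset.sum_congr rfl fun a _ => ?_
  have h3 : ∀ f : Fin N → ℝ, ∏ i, f i = f (σ⁻¹ a) * ∏ i ∈ Finset.univ.erase (σ⁻¹ a), f i :=
    fun f => (Finset.mul_prod_erase _ _ (Finset.mem_univ _)).symm
  rw [h3, h3 (fun i => Polynomial.eval (v (σ i)) (descPochhammer ℝ (i : ℕ)))]
  have h4 : ∏ i ∈ Finset.univ.erase (σ⁻¹ a),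
      Polynomial.eval (Function.update v a (v a - 1) (σ i)) (descPochhammer ℝ (i : ℕ)) =
      ∏ i ∈ Finset.univ.erase (σ⁻¹ a), Polynomial.eval (v (σ i)) (descPochhammer ℝ (i : ℕ)) := by
    refine Finset.prod_congr rfl fun i hi => ?_
    rw [Function.update_of_ne]
    rintro rfl
    simp at hi
  rw [h4]
  have h5 : σ (σ⁻¹ a) = a := by simp
  rw [h5, Function.update_self]
  have := hT (v a) (σ⁻¹ a : Fin N)
  linear_combination ((Equiv.Perm.sign σ : ℤ) : ℝ) * (∏ i ∈ Finset.univ.erase (σ⁻¹ a), Polynomial.eval (v (σ i)) (descPochhammer ℝ (i : ℕ))) * this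

open Matrix in
lemma vand_id (N : ℕ) : (vandermonde (fun i : Fin N => ((i : ℕ) : ℝ))).det
    = ∏ i : Fin N, ((Nat.factorial i : ℕ) : ℝ) := by
  rw [det_eval_matrixOfPolynomials_eq_det_vandermonde _ (fun j : Fin N => descPochhammer ℝ (j : ℕ))
      (fun i => descPochhammer_natDegree ℝ i) (fun i => monic_descPochhammer ℝ i)]
  rw [Matrix.det_of_isLowerTriangular]
  · refine Finset.prod_congr rfl fun i _ => ?_
    rw [Matrix.of_apply, descPochhammer_eval_eq_descFactorial, Nat.descFactorial_self]
  · intro i j hij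
    have hij' : (i : ℕ) < j := hij
    rw [Matrix.of_apply, descPochhammer_eval_eq_descFactorial, Nat.descFactorial_of_lt hij',
      Nat.cast_zero]

def Lv (N : ℕ) (x : ℕ → ℕ) (a : Fin N) : ℕ := x (Fin.rev a : Fin N) + a

def Gv (N : ℕ) (l : Fin N → ℕ) : ℝ :=
  (∏ i : Fin N, ∏ j ∈ Finset.Ioi i, ((l j : ℝ) - l i)) / ∏ i, ((l i).factorial : ℝ)

lemma Gv_eq (N : ℕ) (l : Fin N → ℕ) :
    Gv N l = (Matrix.vandermonde (fun i => (l i : ℝ))).det / ∏ i, ((l i).factorial : ℝ) := by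
  rw [Gv, Matrix.det_vandermonde]

lemma card_eq_sum (μ : YoungDiagram) (N : ℕ) (hN : μ.rowLen N = 0) :
    μ.card = ∑ a : Fin N, μ.rowLen a := by
  rw [Fin.sum_univ_eq_sum_range (fun a => μ.rowLen a) N]
  change μ.cells.card = _
  rw [Finset.card_eq_sum_card_fiberwise (f := Prod.fst) (t := Finset.range N)]
  · refine Finset.sum_congr rfl fun a _ => ?_
    rw [YoungDiagram.rowLen_eq_card]
    rfl
  · rintro ⟨i, j⟩ hm
    have h1 : j < μ.rowLen i := YoungDiagram.mem_iff_lt_rowLen.1 hm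
    simp only [Finset.coe_range, Set.mem_Iio]
    by_contra hc
    have := μ.rowLen_anti N i (not_lt.1 hc)
    omega

lemma fac_mul (m : ℕ) (hm : 0 < m) : (m.factorial : ℝ) = m * ((m-1).factorial : ℝ) := by
  exact_mod_cast (Nat.mul_factorial_pred hm.ne').symm

lemma Gv_update (N : ℕ) (l : Fin N → ℕ) (a : Fin N) (ha : 0 < l a) :
    Gv N (Function.update l a (l a - 1)) =
    (l a : ℝ) * (Matrix.vandermonde (Function.update (fun i => (l i : ℝ)) a ((l a : ℝ) - 1))).det /
      ∏ i, ((l i).factorial : ℝ) := by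
  rw [Gv_eq]
  have h1 : (fun i => ((Function.update l a (l a - 1) i : ℕ) : ℝ)) =
      Function.update (fun i => (l i : ℝ)) a ((l a : ℝ) - 1) := by
    funext i
    by_cases hi : i = a
    · subst hi
      simp only [Function.update_self]
      rw [Nat.cast_sub (by omega), Nat.cast_one]
    · simp [Function.update_of_ne hi]
  have h2 : ∏ i, ((l i).factorial : ℝ) =
      l a * ∏ i, ((Function.update l a (l a - 1) i).factorial : ℝ) := by
    rw [← Finset.mul_prod_erase _ _ (Finset.mem_univ a),
      ← Finset.mul_prod_erase _ (fun i => ((Function.update l a (l a - 1) i).factorial : ℝ)) (Finset.mem_univ a)]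
    rw [Function.update_self, fac_mul _ ha, mul_assoc]
    congr 2
    refine Finset.prod_congr rfl fun i hi => ?_
    rw [Function.update_of_ne (Finset.ne_of_mem_erase hi)]
  rw [h1, h2, mul_div_mul_left]
  exact_mod_cast ha.ne'

open Classical in
lemma Gv_rec (μ : YoungDiagram) (N : ℕ) (hN : μ.rowLen N = 0) :
    (μ.card : ℝ) * Gv N (Lv N μ.rowLen) =
      ∑ a : Fin N, if Rem μ a then Gv N (Lv N (remRow μ a).rowLen) else 0 := by
  have hv := vand_rec N (fun i => (Lv N μ.rowLen i : ℝ))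
  have hc : (∑ a : Fin N, (Lv N μ.rowLen a : ℝ)) - ∑ a : Fin N, ((a : ℕ) : ℝ) = μ.card := by
    rw [card_eq_sum μ N hN, ← Finset.sum_sub_distrib]
    simp only [Lv, Nat.cast_add, add_sub_cancel_right, Nat.cast_sum]
    exact Equiv.sum_comp Fin.revPerm (fun a : Fin N => ((μ.rowLen a : ℕ) : ℝ))
  rw [hc] at hv
  rw [Gv_eq, ← mul_div_assoc, ← hv, Finset.sum_div]
  rw [← Equiv.sum_comp Fin.revPerm]
  refine Finset.sum_congr rfl fun a _ => ?_
  rw [Fin.revPerm_apply]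
  generalize hb : Fin.rev a = b
  have hab : a = Fin.rev b := by rw [← hb, Fin.rev_rev]
  have habv : (a : ℕ) = N - (b + 1) := by rw [hab, Fin.val_rev]
  have hbv : (b : ℕ) = N - (a + 1) := by rw [← hb, Fin.val_rev]
  have h2 : b = Fin.rev a := hb.symm
  have hlb : Lv N μ.rowLen b = μ.rowLen a + b := by rw [Lv, ← hab]
  split_ifs with hR
  · have hpos : 0 < Lv N μ.rowLen b := by
      rw [hlb]
      unfold Rem at hR
      omega
    have h3 : Lv N (remRow μ a).rowLen = Function.update (Lv N μ.rowLen) b (Lv N μ.rowLen b - 1) := by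
      funext c
      rw [Lv, rowLen_remRow hR]
      by_cases hcb : c = b
      · subst hcb
        rw [Function.update_self, hlb, ← hab, if_pos rfl]
        unfold Rem at hR
        omega
      · rw [Function.update_of_ne hcb, if_neg, Lv]
        intro h4
        apply hcb
        rw [h2, ← Fin.ext h4, Fin.rev_rev]
    rw [h3, Gv_update N _ b hpos]
  · have han := μ.rowLen_anti a (a+1) (Nat.le_succ _)
    have heq : μ.rowLen (a+1) = μ.rowLen a := by
      unfold Rem at hR
      omega
    have ha := a.2
    rcases Nat.eq_zero_or_pos (b : ℕ) with hb0 | hb0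
    · have h5 : (a : ℕ) + 1 = N := by omega
      rw [h5, hN] at heq
      rw [hlb, ← heq, hb0]
      simp
    · let c : Fin N := ⟨b - 1, by omega⟩
      have hcb : c ≠ b := by
        intro h
        have := congrArg Fin.val h
        simp only [c] at this
        omega
      have hlc : Lv N μ.rowLen c = μ.rowLen a + (b - 1) := by
        have : ((Fin.rev c : Fin N) : ℕ) = a + 1 := by
          rw [Fin.val_rev]
          simp only [c]
          omega
        rw [Lv, this, heq]
      have : (Matrix.vandermonde (Function.update (fun i => (Lv N μ.rowLen i : ℝ)) b
          ((Lv N μ.rowLen b : ℝ) - 1))).det = 0 := by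
        rw [Matrix.det_vandermonde_eq_zero_iff]
        refine ⟨b, c, ?_, hcb.symm⟩
        rw [Function.update_self, Function.update_of_ne hcb, hlb, hlc]
        push_cast [Nat.cast_sub (show 1 ≤ (b : ℕ) from hb0)]
        ring
      rw [this]
      simp

lemma F_eq (N : ℕ) : ∀ (n : ℕ) (μ : YoungDiagram), μ.card = n → μ.rowLen N = 0 →
    (sytCard μ : ℝ) / (n.factorial : ℝ) = Gv N (Lv N μ.rowLen) := by
  classical
  intro n
  induction n with
  | zero =>
    intro μ hμ hN
    have h0 : Lv N μ.rowLen = fun i : Fin N => (i : ℕ) := by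
      funext i
      have h1 := card_eq_sum μ N hN
      rw [hμ] at h1
      have := (Finset.sum_eq_zero_iff.1 h1.symm) (Fin.rev i) (Finset.mem_univ _)
      rw [Lv, this, zero_add]
    rw [sytCard_bot hμ, Gv_eq, h0, vand_id]
    rw [div_self]
    · simp
    · exact Finset.prod_ne_zero_iff.2 fun i _ => by positivity
  | succ n ih =>
    intro μ hμ hN
    have h1 := Gv_rec μ N hN
    have h2 := sytCard_rec (μ := μ) (by omega) N hN
    have h3 : (∑ a : Fin N, if Rem μ a then Gv N (Lv N (remRow μ a).rowLen) else 0) =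
        (sytCard μ : ℝ) / (n.factorial : ℝ) := by
      rw [h2, Nat.cast_sum, Finset.sum_div]
      refine Finset.sum_congr rfl fun a _ => ?_
      split_ifs with hR
      · rw [ih]
        · have := card_remRow hR
          omega
        · rw [rowLen_remRow hR, if_neg (by have := a.2; omega), hN]
      · simp
    rw [h3, hμ] at h1
    have h4 : ((n + 1 : ℕ) : ℝ) ≠ 0 := by positivity
    apply mul_left_cancel₀ h4
    rw [h1, Nat.factorial_succ, Nat.cast_mul]
    have : (n.factorial : ℝ) ≠ 0 := by positivity
    field_simp

lemma pair_ineq (p q r s : ℕ) (hpq : p < q) (hrs : r < s) :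
    ((q : ℝ) - p) * ((s : ℝ) - r) ≤
      (((min (q+1) s : ℕ) : ℝ) - ((min (p+1) r : ℕ) : ℝ)) *
      (((max (q+1) s - 1 : ℕ) : ℝ) - ((max (p+1) r - 1 : ℕ) : ℝ)) := by
  obtain ⟨d, rfl⟩ := Nat.exists_eq_add_of_lt hpq
  obtain ⟨e, rfl⟩ := Nat.exists_eq_add_of_lt hrs
  rcases le_total (p + d + 1 + 1) (r + e + 1) with h1 | h1 <;>
  rcases le_total (p + 1) r with h2 | h2
  · rw [min_eq_left h1, min_eq_left h2, max_eq_right h1, max_eq_right h2]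
    obtain ⟨r, rfl⟩ : ∃ r', r = r' + 1 := ⟨r - 1, by omega⟩
    simp only [Nat.add_sub_cancel]
    push_cast
    nlinarith
  · rw [min_eq_left h1, min_eq_right h2, max_eq_right h1, max_eq_left h2]
    simp only [Nat.add_sub_cancel]
    obtain ⟨a, ha⟩ := Nat.exists_eq_add_of_le h1
    obtain ⟨b, hb⟩ := Nat.exists_eq_add_of_le h2
    have ha' : ((r:ℝ) + e + 1) = p + d + 1 + 1 + a := by exact_mod_cast ha
    have hb' : (p:ℝ) + 1 = r + b := by exact_mod_cast hb
    push_cast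
    have he : (e : ℝ) = b + d + a := by linarith
    have hp : (p : ℝ) = r + b - 1 := by linarith
    rw [he, hp]
    have h3 : (0:ℝ) ≤ a * b := by positivity
    nlinarith
  · rw [min_eq_right h1, min_eq_left h2, max_eq_left h1, max_eq_right h2]
    obtain ⟨r, rfl⟩ : ∃ r', r = r' + 1 := ⟨r - 1, by omega⟩
    simp only [Nat.add_sub_cancel]
    obtain ⟨a, ha⟩ := Nat.exists_eq_add_of_le h1
    obtain ⟨b, hb⟩ := Nat.exists_eq_add_of_le h2
    have ha' : (p:ℝ) + d + 1 + 1 = ((r:ℝ) + 1 + e + 1) + a := by exact_mod_cast ha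
    have hb' : (r:ℝ) + 1 = p + 1 + b := by exact_mod_cast hb
    push_cast
    have hd : (d : ℝ) = e + b + a := by linarith
    have hr : (r : ℝ) = p + b := by linarith
    rw [hd, hr]
    have h3 : (0:ℝ) ≤ a * b := by positivity
    nlinarith
  · rw [min_eq_right h1, min_eq_right h2, max_eq_left h1, max_eq_left h2]
    simp only [Nat.add_sub_cancel]
    push_cast
    nlinarith

lemma fac_ineq (l m : ℕ) :
    ((min (l+1) m).factorial : ℝ) * ((max (l+1) m - 1).factorial : ℝ) ≤
      (l.factorial : ℝ) * (m.factorial : ℝ) := by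
  norm_cast
  rcases le_total (l+1) m with h | h
  · rw [min_eq_left h, max_eq_right h]
    obtain ⟨m, rfl⟩ : ∃ m', m = m' + 1 := ⟨m - 1, by omega⟩
    rw [Nat.add_sub_cancel, Nat.factorial_succ, Nat.factorial_succ]
    have : (l + 1) * (l.factorial * m.factorial) ≤ (m + 1) * (l.factorial * m.factorial) :=
      Nat.mul_le_mul_right _ h
    nlinarith
  · rw [min_eq_right h, max_eq_left h, Nat.add_sub_cancel, mul_comm]

lemma Gv_ineq (N : ℕ) (l m : Fin N → ℕ) (hl : StrictMono l) (hm : StrictMono m) :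
    Gv N l * Gv N m ≤
      Gv N (fun i => min (l i + 1) (m i)) * Gv N (fun i => max (l i + 1) (m i) - 1) := by
  unfold Gv
  rw [div_mul_div_comm, div_mul_div_comm, ← Finset.prod_mul_distrib, ← Finset.prod_mul_distrib,
    ← Finset.prod_mul_distrib, ← Finset.prod_mul_distrib]
  have h0 : ∀ i, ∀ j ∈ Finset.Ioi i, (0:ℝ) ≤ ((l j : ℝ) - l i) * ((m j : ℝ) - m i) := by
    intro i j hj
    have h1 : (l i : ℝ) ≤ l j := by exact_mod_cast (hl (Finset.mem_Ioi.1 hj)).le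
    have h2 : (m i : ℝ) ≤ m j := by exact_mod_cast (hm (Finset.mem_Ioi.1 hj)).le
    exact mul_nonneg (by linarith) (by linarith)
  have hle : ∏ i : Fin N, ((∏ j ∈ Finset.Ioi i, ((l j : ℝ) - l i)) * ∏ j ∈ Finset.Ioi i, ((m j : ℝ) - m i)) ≤
      ∏ i : Fin N, ((∏ j ∈ Finset.Ioi i, (((min (l j + 1) (m j) : ℕ) : ℝ) - ((min (l i + 1) (m i) : ℕ) : ℝ))) *
        ∏ j ∈ Finset.Ioi i, (((max (l j + 1) (m j) - 1 : ℕ) : ℝ) - ((max (l i + 1) (m i) - 1 : ℕ) : ℝ))) := by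
    simp only [← Finset.prod_mul_distrib]
    refine Finset.prod_le_prod (fun i _ => Finset.prod_nonneg (h0 i)) fun i _ => ?_
    exact Finset.prod_le_prod (h0 i) fun j hj =>
      pair_ineq _ _ _ _ (hl (Finset.mem_Ioi.1 hj)) (hm (Finset.mem_Ioi.1 hj))
  apply div_le_div₀
  · refine le_trans (Finset.prod_nonneg fun i _ => ?_) hle
    rw [← Finset.prod_mul_distrib]
    exact Finset.prod_nonneg (h0 i)
  · exact hle
  · exact Finset.prod_pos fun i _ => by positivity
  · exact Finset.prod_le_prod (fun i _ => by positivity) fun i _ => fac_ineq _ _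

lemma Gv_pos (N : ℕ) (l : Fin N → ℕ) (hl : StrictMono l) : 0 < Gv N l := by
  unfold Gv
  apply div_pos
  · refine Finset.prod_pos fun i _ => Finset.prod_pos fun j hj => ?_
    have h1 : (l i : ℝ) < l j := by exact_mod_cast (hl (Finset.mem_Ioi.1 hj))
    linarith
  · exact Finset.prod_pos fun i _ => by positivity

lemma Lv_strictMono (N : ℕ) (x : ℕ → ℕ) (hx : Antitone x) : StrictMono (Lv N x) := by
  intro a b hab
  have h1 : ((Fin.rev b : Fin N) : ℕ) ≤ (Fin.rev a : Fin N) := by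
    rw [Fin.val_rev, Fin.val_rev]
    have : (a : ℕ) < b := hab
    omega
  have h2 := hx h1
  have : (a : ℕ) < b := hab
  unfold Lv
  omega

def Wv (α β : ℝ) (N : ℕ) (x : ℕ → ℕ) : ℝ :=
  α ^ (∑ a : Fin N, x a) * (Gv N (Lv N x)) ^ β

lemma Wv_pos (α β : ℝ) (hα : 0 < α) (N : ℕ) (x : ℕ → ℕ) (hx : Antitone x) : 0 < Wv α β N x :=
  mul_pos (pow_pos hα _) (Real.rpow_pos_of_pos (Gv_pos N _ (Lv_strictMono N x hx)) _)

lemma rowLen_antitone (μ : YoungDiagram) : Antitone μ.rowLen := fun a b h => μ.rowLen_anti a b h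

lemma mixedWeight_eq (α β : ℝ) (N : ℕ) (μ : YoungDiagram) (hN : μ.rowLen N = 0) :
    mixedWeight α β μ = Wv α β N μ.rowLen := by
  rw [mixedWeight, Wv, F_eq N _ μ rfl hN, card_eq_sum μ N hN]

lemma Wv_ineq (α β : ℝ) (hα : 0 < α) (hβ : 0 < β) (N : ℕ) (x y : ℕ → ℕ) (hx : Antitone x)
    (hy : Antitone y) :
    Wv α β N x * Wv α β N y ≤
      Wv α β N (fun a => min (x a + 1) (y a)) * Wv α β N (fun a => max (x a + 1) (y a) - 1) := by
  unfold Wv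
  have hmin : Lv N (fun a => min (x a + 1) (y a)) = fun i => min (Lv N x i + 1) (Lv N y i) := by
    funext i; simp only [Lv]; omega
  have hmax : Lv N (fun a => max (x a + 1) (y a) - 1) =
      fun i => max (Lv N x i + 1) (Lv N y i) - 1 := by
    funext i; simp only [Lv]; omega
  have hx' := Lv_strictMono N x hx
  have hy' := Lv_strictMono N y hy
  have hs1 : StrictMono fun i => min (Lv N x i + 1) (Lv N y i) := by
    intro i j hij
    have := hx' hij
    have := hy' hij
    simp only
    omega
  have hs2 : StrictMono fun i => max (Lv N x i + 1) (Lv N y i) - 1 := by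
    intro i j hij
    have := hx' hij
    have := hy' hij
    simp only
    omega
  rw [mul_mul_mul_comm, mul_mul_mul_comm (α ^ (∑ a : Fin N, min (x a + 1) (y a))),
    ← pow_add, ← pow_add, ← Finset.sum_add_distrib, ← Finset.sum_add_distrib]
  have hsum : ∑ i : Fin N, (x i + y i) =
      ∑ i : Fin N, (min (x i + 1) (y i) + (max (x i + 1) (y i) - 1)) :=
    Finset.sum_congr rfl fun i _ => by omega
  rw [hsum, hmin, hmax]
  apply mul_le_mul_of_nonneg_left _ (pow_pos hα _).le
  have p1 := (Gv_pos N _ hx').le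
  have p2 := (Gv_pos N _ hy').le
  rw [← Real.mul_rpow p1 p2, ← Real.mul_rpow (Gv_pos N _ hs1).le (Gv_pos N _ hs2).le]
  exact Real.rpow_le_rpow (mul_nonneg p1 p2) (Gv_ineq N _ _ hx' hy') hβ.le

lemma exists_yd (N : ℕ) (x : ℕ → ℕ) (hx : Antitone x) (hN : x N = 0) :
    ∃ μ : YoungDiagram, μ.rowLen = x := by
  refine ⟨⟨((Finset.range N) ×ˢ Finset.range (x 0)).filter (fun c => c.2 < x c.1), ?_⟩, ?_⟩
  · rintro ⟨i, j⟩ ⟨i', j'⟩ hle hm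
    have h1 : i' ≤ i := hle.1
    have h2 : j' ≤ j := hle.2
    simp only [Finset.mem_coe, Finset.mem_filter, Finset.mem_product, Finset.mem_range] at hm ⊢
    have := hx h1
    omega
  · funext i
    apply rowLen_ext
    intro j
    rw [← YoungDiagram.mem_cells]
    simp only [Finset.mem_filter, Finset.mem_product, Finset.mem_range]
    have h0 := hx (Nat.zero_le i)
    constructor
    · exact fun h => h.2
    · intro h
      refine ⟨⟨?_, by omega⟩, h⟩
      by_contra hc
      have := hx (not_lt.1 hc)
      omega

lemma rowLen_inj {μ ν : YoungDiagram} (h : μ.rowLen = ν.rowLen) : μ = ν := by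
  apply YoungDiagram.ext
  ext ⟨i, j⟩
  rw [YoungDiagram.mem_cells, YoungDiagram.mem_cells, YoungDiagram.mem_iff_lt_rowLen,
    YoungDiagram.mem_iff_lt_rowLen, h]

lemma mixedWeight_pos (α β : ℝ) (hα : 0 < α) (μ : YoungDiagram) : 0 < mixedWeight α β μ := by
  have hN : μ.rowLen (μ.colLen 0) = 0 := by
    by_contra h
    have h1 : (μ.colLen 0, 0) ∈ μ := YoungDiagram.mem_iff_lt_rowLen.2 (Nat.pos_of_ne_zero h)
    rw [YoungDiagram.mem_iff_lt_colLen] at h1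
    omega
  rw [mixedWeight_eq α β _ μ hN]
  exact Wv_pos α β hα _ _ (rowLen_antitone μ)

open Classical in
def qk (α β : ℝ) (i k : ℕ) (μ : YoungDiagram) : ℝ :=
  if μ.rowLen i = k then mixedWeight α β μ else 0

open Classical in
def fk (α β : ℝ) (N i k : ℕ) (x : ℕ → ℕ) : ℝ :=
  if (Antitone x ∧ x N = 0) ∧ x i = k then Wv α β N x else 0

open Classical in
def gk (α β : ℝ) (N i k : ℕ) (x : ℕ → ℕ) : ℝ :=
  if ∀ a, 1 ≤ x a then fk α β N i k (fun a => x a - 1) else 0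

lemma qk_nonneg (α β : ℝ) (hα : 0 < α) (i k : ℕ) (μ : YoungDiagram) : 0 ≤ qk α β i k μ := by
  unfold qk
  split_ifs
  · exact (mixedWeight_pos α β hα μ).le
  · exact le_rfl

lemma fk_nonneg (α β : ℝ) (hα : 0 < α) (N i k : ℕ) (x : ℕ → ℕ) : 0 ≤ fk α β N i k x := by
  unfold fk
  split_ifs with h
  · exact (Wv_pos α β hα N x h.1.1).le
  · exact le_rfl

lemma gk_nonneg (α β : ℝ) (hα : 0 < α) (N i k : ℕ) (x : ℕ → ℕ) : 0 ≤ gk α β N i k x := by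
  unfold gk
  split_ifs with h
  · exact fk_nonneg α β hα _ _ _ _
  · exact le_rfl

lemma qk_summable (α β : ℝ) (hα : 0 < α) (i k : ℕ) (hs : Summable (mixedWeight α β)) :
    Summable (qk α β i k) := by
  refine Summable.of_nonneg_of_le (qk_nonneg α β hα i k) (fun μ => ?_) hs
  unfold qk
  split_ifs
  · exact le_rfl
  · exact (mixedWeight_pos α β hα μ).le

lemma sum_fk_le (α β : ℝ) (hα : 0 < α) (N i k : ℕ) (hs : Summable (mixedWeight α β))
    (F : Finset (ℕ → ℕ)) : ∑ x ∈ F, fk α β N i k x ≤ ∑' μ, qk α β i k μ := by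
  classical
  have hg : ∀ x : ℕ → ℕ, ∃ μ : YoungDiagram, (Antitone x ∧ x N = 0) → μ.rowLen = x := by
    intro x
    by_cases h : Antitone x ∧ x N = 0
    · obtain ⟨μ, hμ⟩ := exists_yd N x h.1 h.2
      exact ⟨μ, fun _ => hμ⟩
    · exact ⟨⊥, fun h' => absurd h' h⟩
  choose g hg using hg
  have h1 : ∑ x ∈ F, fk α β N i k x =
      ∑ x ∈ F.filter (fun x => Antitone x ∧ x N = 0), qk α β i k (g x) := by
    rw [Finset.sum_filter]
    refine Finset.sum_congr rfl fun x _ => ?_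
    unfold fk qk
    by_cases h : Antitone x ∧ x N = 0
    · have hN : (g x).rowLen N = 0 := by rw [hg x h]; exact h.2
      rw [if_pos h, mixedWeight_eq α β N _ hN, hg x h]
      simp [h]
    · rw [if_neg h, if_neg (fun h' => h h'.1)]
  rw [h1]
  have hinj : Set.InjOn g ↑(F.filter (fun x => Antitone x ∧ x N = 0)) := by
    intro x hx y hy hxy
    have hx' := (Finset.mem_filter.1 (Finset.mem_coe.1 hx)).2
    have hy' := (Finset.mem_filter.1 (Finset.mem_coe.1 hy)).2
    rw [← hg x hx', ← hg y hy', hxy]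
  rw [← Finset.sum_image (f := qk α β i k) hinj]
  exact (qk_summable α β hα i k hs).sum_le_tsum _ (fun μ _ => qk_nonneg α β hα i k μ)

lemma sum_gk_le (α β : ℝ) (hα : 0 < α) (N i k : ℕ) (hs : Summable (mixedWeight α β))
    (F : Finset (ℕ → ℕ)) : ∑ x ∈ F, gk α β N i k x ≤ ∑' μ, qk α β i k μ := by
  classical
  unfold gk
  rw [← Finset.sum_filter]
  have hinj : Set.InjOn (fun (x : ℕ → ℕ) (a : ℕ) => x a - 1)
      ↑(F.filter (fun x => ∀ a, 1 ≤ x a)) := by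
    intro x hx y hy hxy
    have hx' := (Finset.mem_filter.1 (Finset.mem_coe.1 hx)).2
    have hy' := (Finset.mem_filter.1 (Finset.mem_coe.1 hy)).2
    funext a
    have h1 := congrFun hxy a
    have h2 := hx' a
    have h3 := hy' a
    simp only at h1
    omega
  rw [← Finset.sum_image (f := fk α β N i k) hinj]
  exact sum_fk_le α β hα N i k hs _

lemma four_hyp (α β : ℝ) (hα : 0 < α) (hβ : 0 < β) (N i k : ℕ) (hk : 1 ≤ k) (y z : ℕ → ℕ) :
    gk α β N i (k-1) y * fk α β N i (k+1) z ≤ fk α β N i k (y ⊓ z) * gk α β N i k (y ⊔ z) := by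
  have hn : 0 ≤ fk α β N i k (y ⊓ z) * gk α β N i k (y ⊔ z) :=
    mul_nonneg (fk_nonneg α β hα _ _ _ _) (gk_nonneg α β hα _ _ _ _)
  by_cases h1 : ∀ a, 1 ≤ y a
  swap
  · rw [gk, if_neg h1, zero_mul]; exact hn
  by_cases h2 : (Antitone (fun a => y a - 1) ∧ y N - 1 = 0) ∧ y i - 1 = k - 1
  swap
  · rw [gk, if_pos h1, fk, if_neg h2, zero_mul]; exact hn
  by_cases h3 : (Antitone z ∧ z N = 0) ∧ z i = k + 1
  swap
  · rw [fk, if_neg h3, mul_zero]; exact hn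
  obtain ⟨⟨ha, hN⟩, hi⟩ := h2
  obtain ⟨⟨ha', hN'⟩, hi'⟩ := h3
  obtain ⟨x, rfl⟩ : ∃ x : ℕ → ℕ, y = fun a => x a + 1 :=
    ⟨fun a => y a - 1, by funext a; have := h1 a; simp only; omega⟩
  simp only [Nat.add_sub_cancel] at ha hN hi
  have e1 : ((fun a => x a + 1) ⊓ z) = fun a => min (x a + 1) (z a) := rfl
  have e2 : ((fun a => x a + 1) ⊔ z) = fun a => max (x a + 1) (z a) := rfl
  rw [e1, e2]
  have ha : Antitone x := ha
  rw [gk, if_pos h1, fk, if_pos, fk, if_pos, fk, if_pos, gk, if_pos, fk, if_pos]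
  · exact Wv_ineq α β hα hβ N x z ha ha'
  · refine ⟨⟨fun a b hab => ?_, ?_⟩, ?_⟩
    · have := ha hab
      have := ha' hab
      simp only
      omega
    · omega
    · omega
  · intro a; omega
  · refine ⟨⟨fun a b hab => ?_, ?_⟩, ?_⟩
    · have := ha hab
      have := ha' hab
      simp only
      omega
    · omega
    · omega
  · exact ⟨⟨ha', hN'⟩, hi'⟩
  · simp only [Nat.add_sub_cancel]
    exact ⟨⟨ha, hN⟩, hi⟩

lemma exists_N (s : Finset YoungDiagram) : ∃ N, ∀ μ ∈ s, μ.rowLen N = 0 := by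
  refine ⟨s.sup (fun μ => μ.colLen 0), fun μ hμ => ?_⟩
  by_contra h
  have h1 := YoungDiagram.mem_iff_lt_rowLen.2 (Nat.pos_of_ne_zero h)
  rw [YoungDiagram.mem_iff_lt_colLen] at h1
  have : μ.colLen 0 ≤ s.sup (fun μ => μ.colLen 0) :=
    Finset.le_sup (f := fun μ : YoungDiagram => μ.colLen 0) hμ
  omega

lemma finite_ineq (α β : ℝ) (hα : 0 < α) (hβ : 0 < β) (i k : ℕ) (hk : 1 ≤ k)
    (hs : Summable (mixedWeight α β)) (s : Finset YoungDiagram) :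
    (∑ μ ∈ s, qk α β i (k-1) μ) * (∑ μ ∈ s, qk α β i (k+1) μ) ≤ (∑' μ, qk α β i k μ) ^ 2 := by
  classical
  obtain ⟨N, hN⟩ := exists_N s
  have e1 : ∑ μ ∈ s, qk α β i (k-1) μ =
      ∑ y ∈ s.image (fun μ => fun a => μ.rowLen a + 1), gk α β N i (k-1) y := by
    rw [Finset.sum_image]
    · refine Finset.sum_congr rfl fun μ hμ => ?_
      rw [qk, gk, if_pos (fun a => by omega), fk, mixedWeight_eq α β N μ (hN μ hμ)]
      simp only [Nat.add_sub_cancel]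
      have : Antitone (fun a => μ.rowLen a) := rowLen_antitone μ
      simp [this, hN μ hμ]
    · intro μ _ ν _ h
      apply rowLen_inj
      funext a
      have := congrFun h a
      simpa using this
  have e2 : ∑ μ ∈ s, qk α β i (k+1) μ = ∑ y ∈ s.image (fun μ => μ.rowLen), fk α β N i (k+1) y := by
    rw [Finset.sum_image]
    · refine Finset.sum_congr rfl fun μ hμ => ?_
      rw [qk, fk, mixedWeight_eq α β N μ (hN μ hμ)]
      simp [rowLen_antitone μ, hN μ hμ]
    · intro μ _ ν _ h
      exact rowLen_inj h
  rw [e1, e2]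
  refine (four_functions_theorem _ _ (fk α β N i k) (gk α β N i k)
    (gk_nonneg α β hα N i (k-1)) (fk_nonneg α β hα N i (k+1)) (fk_nonneg α β hα N i k)
    (gk_nonneg α β hα N i k) (four_hyp α β hα hβ N i k hk) _ _).trans ?_
  rw [sq]
  exact mul_le_mul (sum_fk_le α β hα N i k hs _) (sum_gk_le α β hα N i k hs _)
    (Finset.sum_nonneg fun x _ => gk_nonneg α β hα N i k x)
    (tsum_nonneg (qk_nonneg α β hα i k))

lemma tsum_ineq (α β : ℝ) (hα : 0 < α) (hβ : 0 < β) (i k : ℕ) (hk : 1 ≤ k)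
    (hs : Summable (mixedWeight α β)) :
    (∑' μ, qk α β i (k-1) μ) * (∑' μ, qk α β i (k+1) μ) ≤ (∑' μ, qk α β i k μ) ^ 2 := by
  have h1 := (qk_summable α β hα i (k-1) hs).hasSum
  have h2 := (qk_summable α β hα i (k+1) hs).hasSum
  exact le_of_tendsto' (Filter.Tendsto.mul h1 h2) (fun s => finite_ineq α β hα hβ i k hk hs s)

lemma mixedRowProb_eq (α β : ℝ) (i k : ℕ) :
    mixedRowProb α β i k = (∑' μ, qk α β (i-1) k μ) / ∑' τ : YoungDiagram, mixedWeight α β τ := by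
  unfold mixedRowProb mixedProb
  rw [tsum_div_const]
  congr 1
  have h := tsum_subtype {μ : YoungDiagram | μ.rowLen (i-1) = k} (mixedWeight α β)
  refine h.trans (tsum_congr fun μ => ?_)
  unfold qk
  rw [Set.indicator_apply]
  rfl

lemma main_ns (α β : ℝ) (i k : ℕ) (hs : ¬ Summable (mixedWeight α β)) :
    mixedRowProb α β i k = 0 := by
  rw [mixedRowProb_eq, tsum_eq_zero_of_not_summable hs, div_zero]

lemma row_pos (α β : ℝ) (hα : 0 < α) (i k : ℕ) (hs : Summable (mixedWeight α β)) :
    0 < mixedRowProb α β i k := by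
  rw [mixedRowProb_eq]
  apply div_pos
  · obtain ⟨μ, hμ⟩ := exists_yd (i - 1 + 1) (fun a => if a ≤ i - 1 then k else 0)
      (by
        intro a b hab
        simp only
        split_ifs <;> omega)
      (by simp)
    refine (qk_summable α β hα (i-1) k hs).tsum_pos (qk_nonneg α β hα (i-1) k) μ ?_
    rw [qk, if_pos (by rw [hμ]; simp)]
    exact mixedWeight_pos α β hα μ
  · exact hs.tsum_pos (fun μ => (mixedWeight_pos α β hα μ).le) ⊥ (mixedWeight_pos α β hα ⊥)

/-- Under the mixed measure `M^(α,β)` (α, β > 0), the distribution of the length of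
the `i`-th row is log-concave on ℕ: the pmf satisfies the log-concavity inequality at
every `k ≥ 1` and its support is an interval of integers. -/
theorem logConcave_row_mixed_plancherel (α β : ℝ) (hα : 0 < α) (hβ : 0 < β)
    (i : ℕ) (hi : 1 ≤ i) :
    (∀ k : ℕ, 1 ≤ k →
      mixedRowProb α β i (k - 1) * mixedRowProb α β i (k + 1) ≤ (mixedRowProb α β i k) ^ 2) ∧
    (∀ k₁ k₂ k₃ : ℕ, k₁ ≤ k₂ → k₂ ≤ k₃ →
      0 < mixedRowProb α β i k₁ → 0 < mixedRowProb α β i k₃ →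
      0 < mixedRowProb α β i k₂) := by
  by_cases hs : Summable (mixedWeight α β)
  · refine ⟨fun k hk => ?_, fun _ k₂ _ _ _ _ _ => row_pos α β hα i k₂ hs⟩
    rw [mixedRowProb_eq, mixedRowProb_eq, mixedRowProb_eq, div_mul_div_comm, div_pow, ← sq]
    exact div_le_div_of_nonneg_right (tsum_ineq α β hα hβ (i-1) k hk hs) (sq_nonneg _)
  · refine ⟨fun k hk => ?_, fun k₁ _ _ _ _ h _ => ?_⟩
    · rw [main_ns α β i _ hs, zero_mul]
      exact sq_nonneg _
    · rw [main_ns α β i k₁ hs] at h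
      exact absurd h (lt_irrefl _)
end
end

section
/- Let m ≥ n ≥ 1 be integers and q ∈ (0,1). Under the Meixner ensemble P_{n,m,Me}, i.e. the probability measure on {h ∈ ℕ^n : h_1 < ⋯ < h_n} with P(h) proportional to ∏_{1≤i<j≤n}(h_j − h_i)² · ∏_{j=1}^n binom(h_j + m − n, h_j) q^{h_j}, every one-dimensional marginal h_i has a log-concave distribution on ℕ: P(h_i = k−1)·P(h_i = k+1) ≤ P(h_i = k)² for all k ≥ 1. In particular the largest point h_n has a log-concave distribution. -/
open scoped BigOperators

noncomputable section

/-- Unnormalized Meixner weight of a configuration `h`: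
`∏_{i<j} (h_j - h_i)² · ∏_j binom(h_j + m - n, h_j) q^{h_j}`. -/
def meixnerWeight (n m : ℕ) (q : ℝ) (h : Fin n → ℕ) : ℝ :=
  (∏ i : Fin n, ∏ j : Fin n, if i < j then ((h j : ℝ) - (h i : ℝ)) ^ 2 else 1) *
    ∏ j : Fin n, (Nat.choose (h j + m - n) (h j) : ℝ) * q ^ (h j)

/-- `P_{n,m,Me}(h_i = k)`: the Meixner-ensemble probability that the `i`-th point
equals `k`. -/
def meixnerProb (n m : ℕ) (q : ℝ) (i : Fin n) (k : ℕ) : ℝ :=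
  (∑' h : {h : Fin n → ℕ // StrictMono h ∧ h i = k}, meixnerWeight n m q h.1) /
    ∑' h : {h : Fin n → ℕ // StrictMono h}, meixnerWeight n m q h.1

lemma mx_onebody (d x z : ℕ) (h : x ≤ z) :
    (Nat.choose (x + d) x : ℝ) * Nat.choose (z + 1 + d) (z + 1) ≤
      Nat.choose (x + 1 + d) (x + 1) * Nat.choose (z + d) z := by
  have key : ∀ t : ℕ, (Nat.choose (t + 1 + d) (t + 1) : ℝ) * (t + 1) =
      (t + d + 1) * Nat.choose (t + d) t := by
    intro t
    have := Nat.add_one_mul_choose_eq (t + d) t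
    rw [show t + 1 + d = t + d + 1 by ring]
    exact_mod_cast this.symm
  have h1 := key x
  have h2 := key z
  have hx : (0:ℝ) < (x:ℝ) + 1 := by positivity
  have hz : (0:ℝ) < (z:ℝ) + 1 := by positivity
  have hxz : (x:ℝ) ≤ z := by exact_mod_cast h
  refine le_of_mul_le_mul_right ?_ (mul_pos hx hz)
  set A := (Nat.choose (x + d) x : ℝ)
  set B := (Nat.choose (z + d) z : ℝ)
  have hA : 0 ≤ A := Nat.cast_nonneg _
  have hB : 0 ≤ B := Nat.cast_nonneg _
  calc _ = A * ((Nat.choose (z + 1 + d) (z + 1) : ℝ) * (z+1)) * (x+1) := by ring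
    _ = (A * B) * ((z + d + 1) * (x + 1)) := by rw [h2]; ring
    _ ≤ (A * B) * ((x + d + 1) * (z + 1)) := by
        apply mul_le_mul_of_nonneg_left _ (mul_nonneg hA hB)
        have : (0:ℝ) ≤ d * ((z:ℝ) - x) := mul_nonneg (Nat.cast_nonneg _) (by linarith)
        nlinarith
    _ = ((Nat.choose (x + 1 + d) (x + 1) : ℝ) * (x+1)) * B * (z + 1) := by rw [h1]; ring
    _ = _ := by ring

lemma mx_onebody' (n m : ℕ) (hm : n ≤ m) (q : ℝ) (hq0 : 0 < q) (x y : ℕ) :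
    ((Nat.choose (x + m - n) x : ℝ) * q ^ x) * ((Nat.choose (y + m - n) y : ℝ) * q ^ y) ≤
      ((Nat.choose (min (x+1) y + m - n) (min (x+1) y) : ℝ) * q ^ (min (x+1) y)) *
      ((Nat.choose (max (x+1) y - 1 + m - n) (max (x+1) y - 1) : ℝ) *
        q ^ (max (x+1) y - 1)) := by
  obtain ⟨d, rfl⟩ := Nat.exists_eq_add_of_le hm
  have e : ∀ t : ℕ, t + (n + d) - n = t + d := fun t => by omega
  simp only [e]
  rcases Nat.lt_or_ge x y with h | h
  · obtain ⟨z, rfl⟩ : ∃ z, y = z + 1 := ⟨y - 1, by omega⟩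
    rw [min_eq_left (by omega), max_eq_right (by omega), Nat.add_sub_cancel]
    have := mx_onebody d x z (by omega)
    calc _ = ((Nat.choose (x + d) x : ℝ) * Nat.choose (z + 1 + d) (z + 1)) * q ^ (x + z + 1) := by
          ring
      _ ≤ (Nat.choose (x + 1 + d) (x + 1) * Nat.choose (z + d) z) * q ^ (x + z + 1) :=
          mul_le_mul_of_nonneg_right this (by positivity)
      _ = _ := by ring
  · rw [min_eq_right (by omega), max_eq_left (by omega), Nat.add_sub_cancel, mul_comm]

lemma mx_twobody (a b c d : ℝ) (h1 : a < b) (h2 : c < d) :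
    (b - a) ^ 2 * (d - c) ^ 2 ≤
      (min b d - min a c) ^ 2 * (max b d - max a c) ^ 2 := by
  rw [← mul_pow, ← mul_pow]
  have hp : 0 ≤ (b - a) * (d - c) := mul_nonneg (by linarith) (by linarith)
  apply pow_le_pow_left₀ hp
  rcases le_total b d with h3 | h3 <;> rcases le_total a c with h4 | h4 <;>
    simp only [min_eq_left, min_eq_right, max_eq_left, max_eq_right, h3, h4]
  · exact le_refl _
  · nlinarith [mul_nonneg (sub_nonneg.2 h3) (sub_nonneg.2 h4)]
  · nlinarith [mul_nonneg (sub_nonneg.2 h3) (sub_nonneg.2 h4)]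
  · exact (mul_comm _ _).le

lemma mx_nonneg (n m : ℕ) (q : ℝ) (hq0 : 0 < q) (h : Fin n → ℕ) :
    0 ≤ meixnerWeight n m q h := by
  unfold meixnerWeight
  apply mul_nonneg
  · refine Finset.prod_nonneg fun i _ => Finset.prod_nonneg fun j _ => ?_
    split_ifs <;> positivity
  · exact Finset.prod_nonneg fun i _ => by positivity

lemma mx_pos (n m : ℕ) (hm : n ≤ m) (q : ℝ) (hq0 : 0 < q) (h : Fin n → ℕ) (hh : StrictMono h) :
    0 < meixnerWeight n m q h := by
  unfold meixnerWeight
  apply mul_pos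
  · refine Finset.prod_pos fun i _ => Finset.prod_pos fun j _ => ?_
    split_ifs with hij
    · have : (h i : ℝ) < h j := by exact_mod_cast hh hij
      have : 0 < (h j : ℝ) - h i := by linarith
      positivity
    · exact one_pos
  · refine Finset.prod_pos fun i _ => ?_
    have : 0 < Nat.choose (h i + m - n) (h i) := Nat.choose_pos (by omega)
    positivity

lemma mx_four (n m : ℕ) (hm : n ≤ m) (q : ℝ) (hq0 : 0 < q) (x y : Fin n → ℕ)
    (hx : StrictMono x) (hy : StrictMono y) :
    meixnerWeight n m q x * meixnerWeight n m q y ≤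
      meixnerWeight n m q (fun j => min (x j + 1) (y j)) *
      meixnerWeight n m q (fun j => max (x j + 1) (y j) - 1) := by
  unfold meixnerWeight
  rw [mul_mul_mul_comm, mul_mul_mul_comm (∏ i : Fin n, ∏ j : Fin n,
    if i < j then (((min (x j + 1) (y j) : ℕ) : ℝ) - ((min (x i + 1) (y i) : ℕ) : ℝ)) ^ 2 else 1)]
  apply mul_le_mul <;> simp only [← Finset.prod_mul_distrib]
  · refine Finset.prod_le_prod (fun i _ => Finset.prod_nonneg fun j _ => ?_) fun i _ =>
      Finset.prod_le_prod (fun j _ => ?_) fun j _ => ?_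
    · split_ifs <;> positivity
    · split_ifs <;> positivity
    · split_ifs with hij
      · have h1 : (x i : ℝ) + 1 < x j + 1 := by
          have := hx hij
          exact_mod_cast Nat.succ_lt_succ this
        have h2 : (y i : ℝ) < y j := by exact_mod_cast hy hij
        have := mx_twobody _ _ _ _ h1 h2
        have e : ∀ t, (((max (x t + 1) (y t) - 1 : ℕ)) : ℝ) = max ((x t : ℝ) + 1) (y t) - 1 := by
          intro t
          rw [Nat.cast_sub (le_max_of_le_left (by omega))]
          push_cast; rfl
        rw [e, e]
        push_cast
        calc _ = ((x j : ℝ) + 1 - (x i + 1)) ^ 2 * ((y j : ℝ) - y i) ^ 2 := by ring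
          _ ≤ _ := this
          _ = _ := by ring
      · simp
  · exact Finset.prod_le_prod (fun i _ => by positivity) fun i _ =>
      mx_onebody' n m hm q hq0 (x i) (y i)
  · exact Finset.prod_nonneg fun i _ => by positivity
  · refine Finset.prod_nonneg fun i _ => Finset.prod_nonneg fun j _ => ?_
    split_ifs <;> positivity

lemma mx_sum_pi (n : ℕ) (g : ℕ → ℝ) (hg0 : ∀ k, 0 ≤ g k) (hg : Summable g) :
    Summable fun h : Fin n → ℕ => ∏ j, g (h j) := by
  apply summable_of_sum_le (c := ∏ _j : Fin n, ∑' k, g k)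
  · intro h; exact Finset.prod_nonneg fun _ _ => hg0 _
  · intro u
    let s : Fin n → Finset ℕ := fun j => u.image fun h => h j
    calc ∑ h ∈ u, ∏ j, g (h j) ≤ ∑ h ∈ Fintype.piFinset s, ∏ j, g (h j) := by
          apply Finset.sum_le_sum_of_subset_of_nonneg
          · intro h hh
            rw [Fintype.mem_piFinset]
            intro j
            exact Finset.mem_image_of_mem _ hh
          · intro h _ _; exact Finset.prod_nonneg fun _ _ => hg0 _
      _ = ∏ j, ∑ k ∈ s j, g k := (Finset.prod_univ_sum s (fun _ k => g k)).symm
      _ ≤ _ := Finset.prod_le_prod (fun j _ => Finset.sum_nonneg fun _ _ => hg0 _)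
          fun j _ => hg.sum_le_tsum _ fun _ _ => hg0 _

lemma mx_summable (n m : ℕ) (hm : n ≤ m) (q : ℝ) (hq0 : 0 < q) (hq1 : q < 1) :
    Summable (meixnerWeight n m q) := by
  obtain ⟨d, rfl⟩ := Nat.exists_eq_add_of_le hm
  have hg : Summable fun k : ℕ =>
      ((k:ℝ) + 1 + d) ^ (4 * n + d) * q ^ k := by
    have h := summable_pow_mul_geometric_of_norm_lt_one (4 * n + d) (r := q)
      (by rw [Real.norm_eq_abs, abs_of_pos hq0]; exact hq1)
    have h2 := ((summable_nat_add_iff (1 + d)).2 h).mul_right ((q ^ (1 + d))⁻¹)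
    refine h2.congr fun k => ?_
    push_cast
    rw [pow_add q k]
    field_simp
    ring
  refine Summable.of_nonneg_of_le (mx_nonneg n _ q hq0) (fun h => ?_)
    (mx_sum_pi n _ (fun k => by positivity) hg)
  unfold meixnerWeight
  calc _ ≤ (∏ i : Fin n, ∏ j : Fin n, ((h i : ℝ) + 1 + d) ^ 2 * ((h j : ℝ) + 1 + d) ^ 2) *
        ∏ j : Fin n, ((h j : ℝ) + 1 + d) ^ d * q ^ (h j) := by
        apply mul_le_mul
        · refine Finset.prod_le_prod (fun i _ => Finset.prod_nonneg fun j _ => ?_) fun i _ =>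
            Finset.prod_le_prod (fun j _ => ?_) fun j _ => ?_
          · split_ifs <;> positivity
          · split_ifs <;> positivity
          · have hi : (0:ℝ) ≤ h i := Nat.cast_nonneg _
            have hj : (0:ℝ) ≤ h j := Nat.cast_nonneg _
            have hd : (0:ℝ) ≤ d := Nat.cast_nonneg _
            rw [← mul_pow]
            have hh : 0 ≤ ((h i : ℝ) + d) * (h j + d) := by positivity
            split_ifs
            · apply sq_le_sq'
              · nlinarith
              · nlinarith
            · apply one_le_pow₀
              nlinarith
        · refine Finset.prod_le_prod (fun i _ => by positivity) fun i _ => ?_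
          apply mul_le_mul_of_nonneg_right _ (by positivity)
          rw [show h i + (n + d) - n = h i + d by omega, Nat.choose_symm_add]
          have h1 := Nat.choose_le_pow (h i + d) d
          calc ((Nat.choose (h i + d) d : ℕ) : ℝ) ≤ ((h i + d) ^ d : ℕ) := by
                exact_mod_cast h1
            _ ≤ _ := by
              push_cast
              apply pow_le_pow_left₀ (by positivity)
              linarith
        · exact Finset.prod_nonneg fun i _ => by positivity
        · exact Finset.prod_nonneg fun i _ => Finset.prod_nonneg fun j _ => by positivity
    _ = _ := by
        simp only [Finset.prod_mul_distrib, Finset.prod_const, Finset.card_univ, Fintype.card_fin,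
          pow_add]
        simp only [Finset.prod_pow]
        ring

open Classical in
/-- restricted weight -/
def mxG (n m : ℕ) (q : ℝ) (i : Fin n) (k : ℕ) (h : Fin n → ℕ) : ℝ :=
  if StrictMono h ∧ h i = k then meixnerWeight n m q h else 0

lemma mxG_nonneg (n m : ℕ) (q : ℝ) (hq0 : 0 < q) (i : Fin n) (k : ℕ) (h : Fin n → ℕ) :
    0 ≤ mxG n m q i k h := by
  unfold mxG
  split_ifs
  · exact mx_nonneg n m q hq0 h
  · exact le_refl _

lemma mxG_tsum (n m : ℕ) (q : ℝ) (i : Fin n) (k : ℕ) :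
    ∑' h : {h : Fin n → ℕ // StrictMono h ∧ h i = k}, meixnerWeight n m q h.1 =
      ∑' h, mxG n m q i k h := by
  classical
  have := tsum_subtype {h : Fin n → ℕ | StrictMono h ∧ h i = k} (meixnerWeight n m q)
  refine this.trans (tsum_congr fun h => ?_)
  simp only [mxG, Set.indicator, Set.mem_ofPred_eq]
  congr

lemma mxG_summable (n m : ℕ) (hm : n ≤ m) (q : ℝ) (hq0 : 0 < q) (hq1 : q < 1)
    (i : Fin n) (k : ℕ) : Summable (mxG n m q i k) := by
  refine Summable.of_nonneg_of_le (mxG_nonneg n m q hq0 i k) (fun h => ?_)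
    (mx_summable n m hm q hq0 hq1)
  unfold mxG
  split_ifs
  · exact le_refl _
  · exact mx_nonneg n m q hq0 h

lemma mxG_four (n m : ℕ) (hm : n ≤ m) (q : ℝ) (hq0 : 0 < q) (i : Fin n) (k : ℕ)
    (x y : Fin n → ℕ) :
    mxG n m q i k x * mxG n m q i (k + 2) y ≤
      mxG n m q i (k + 1) (fun j => min (x j + 1) (y j)) *
      mxG n m q i (k + 1) (fun j => max (x j + 1) (y j) - 1) := by
  by_cases hx : StrictMono x ∧ x i = k
  swap
  · rw [mxG, if_neg hx, zero_mul]
    exact mul_nonneg (mxG_nonneg _ _ _ hq0 _ _ _) (mxG_nonneg _ _ _ hq0 _ _ _)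
  by_cases hy : StrictMono y ∧ y i = k + 2
  swap
  · rw [mul_comm, mxG, if_neg hy, zero_mul]
    exact mul_nonneg (mxG_nonneg _ _ _ hq0 _ _ _) (mxG_nonneg _ _ _ hq0 _ _ _)
  have h1 : StrictMono (fun j => min (x j + 1) (y j)) ∧ min (x i + 1) (y i) = k + 1 := by
    refine ⟨fun a b hab => ?_, by omega⟩
    have := hx.1 hab
    have := hy.1 hab
    show min (x a + 1) (y a) < min (x b + 1) (y b)
    omega
  have h2 : StrictMono (fun j => max (x j + 1) (y j) - 1) ∧ max (x i + 1) (y i) - 1 = k + 1 := by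
    refine ⟨fun a b hab => ?_, by omega⟩
    have := hx.1 hab
    have := hy.1 hab
    show max (x a + 1) (y a) - 1 < max (x b + 1) (y b) - 1
    omega
  unfold mxG
  rw [if_pos hx, if_pos hy, if_pos h1, if_pos h2]
  exact mx_four n m hm q hq0 x y hx.1 hy.1

open Classical in
open scoped FinsetFamily in
lemma mxG_finite (n m : ℕ) (hm : n ≤ m) (q : ℝ) (hq0 : 0 < q) (hq1 : q < 1) (i : Fin n) (k : ℕ)
    (s t : Finset (Fin n → ℕ)) :
    (∑ x ∈ s, mxG n m q i k x) * (∑ y ∈ t, mxG n m q i (k + 2) y) ≤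
      (∑' h, mxG n m q i (k + 1) h) ^ 2 := by
  let f₁ : (Fin n → ℕ) → ℝ := fun a => if ∀ j, 1 ≤ a j then mxG n m q i k (fun j => a j - 1) else 0
  let f₄ : (Fin n → ℕ) → ℝ := fun a =>
    if ∀ j, 1 ≤ a j then mxG n m q i (k + 1) (fun j => a j - 1) else 0
  have hS := mxG_summable n m hm q hq0 hq1 i (k + 1)
  have p := mxG_nonneg n m q hq0 i
  have h1 : 0 ≤ f₁ := by
    intro a
    show 0 ≤ f₁ a
    simp only [f₁]
    split_ifs
    · exact p _ _
    · exact le_refl _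
  have h4 : 0 ≤ f₄ := by
    intro a
    show 0 ≤ f₄ a
    simp only [f₄]
    split_ifs
    · exact p _ _
    · exact le_refl _
  have key := four_functions_theorem (f₁ := f₁) (f₂ := mxG n m q i (k + 2))
    (f₃ := mxG n m q i (k + 1)) (f₄ := f₄) h1 (p _) (p _) h4 (by
      intro a b
      by_cases ha : ∀ j, 1 ≤ a j
      · have hab : ∀ j, 1 ≤ (a ⊔ b) j := fun j => le_trans (ha j) (le_max_left _ _)
        simp only [f₁, f₄]
        rw [if_pos ha, if_pos hab]
        have := mxG_four n m hm q hq0 i k (fun j => a j - 1) b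
        have e : ∀ j, a j - 1 + 1 = a j := fun j => Nat.sub_add_cancel (ha j)
        simp only [e] at this
        exact this
      · have : f₁ a = 0 := if_neg ha
        rw [this, zero_mul]
        exact mul_nonneg (p _ _) (h4 _)) (s.image fun x j => x j + 1) t
  have e1 : ∑ a ∈ s.image (fun x j => x j + 1), f₁ a = ∑ x ∈ s, mxG n m q i k x := by
    rw [Finset.sum_image]
    · refine Finset.sum_congr rfl fun x _ => ?_
      simp [f₁]
    · intro x _ y _ hxy
      funext j
      have := congrFun hxy j
      simpa using this
  rw [e1] at key
  refine key.trans ?_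
  rw [sq]
  refine mul_le_mul (hS.sum_le_tsum _ fun _ _ => p _ _) ?_
    (Finset.sum_nonneg fun a _ => h4 a) (tsum_nonneg (p _))
  generalize HasSups.sups (s.image fun x j => x j + 1) t = u
  rw [← Finset.sum_filter]
  rw [← Finset.sum_image (f := mxG n m q i (k + 1)) (g := fun (a : Fin n → ℕ) j => a j - 1)]
  · exact hS.sum_le_tsum _ fun _ _ => p _ _
  · intro x hx y hy hxy
    funext j
    have := congrFun hxy j
    have h1 := (Finset.mem_filter.1 hx).2 j
    have h2 := (Finset.mem_filter.1 hy).2 j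
    simp only at this
    omega

lemma mxG_logconcave (n m : ℕ) (hm : n ≤ m) (q : ℝ) (hq0 : 0 < q) (hq1 : q < 1)
    (i : Fin n) (k : ℕ) :
    (∑' h, mxG n m q i k h) * (∑' h, mxG n m q i (k + 2) h) ≤
      (∑' h, mxG n m q i (k + 1) h) ^ 2 := by
  have h1 := (mxG_summable n m hm q hq0 hq1 i k).hasSum
  have h2 := (mxG_summable n m hm q hq0 hq1 i (k + 2)).hasSum
  refine le_of_tendsto' (Filter.Tendsto.mul_const _ h1) fun s => ?_
  refine le_of_tendsto' (Filter.Tendsto.const_mul _ h2) fun t => ?_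
  exact mxG_finite n m hm q hq0 hq1 i k s t

/-- Every one-dimensional marginal of the Meixner ensemble (parameters `m ≥ n ≥ 1`,
`q ∈ (0,1)`) has a log-concave distribution on ℕ: the pmf satisfies the log-concavity
inequality for all `k ≥ 1` and has no internal zeros. In particular this holds for the
largest point `h_n`. -/
theorem logConcave_marginal_meixner (n m : ℕ) (hn : 1 ≤ n) (hm : n ≤ m)
    (q : ℝ) (hq0 : 0 < q) (hq1 : q < 1) :
    ∀ i : Fin n,
      (∀ k : ℕ, 1 ≤ k →
        meixnerProb n m q i (k - 1) * meixnerProb n m q i (k + 1) ≤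
          (meixnerProb n m q i k) ^ 2) ∧
      (∀ k₁ k₂ k₃ : ℕ, k₁ ≤ k₂ → k₂ ≤ k₃ →
        0 < meixnerProb n m q i k₁ → 0 < meixnerProb n m q i k₃ →
        0 < meixnerProb n m q i k₂) := by
  intro i
  refine ⟨?_, ?_⟩
  · intro k hk
    obtain ⟨k, rfl⟩ : ∃ z, k = z + 1 := ⟨k - 1, by omega⟩
    have := mxG_logconcave n m hm q hq0 hq1 i k
    simp only [meixnerProb, mxG_tsum, Nat.add_sub_cancel]
    rw [div_mul_div_comm, div_pow, ← sq]
    exact div_le_div_of_nonneg_right this (sq_nonneg _)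
  · intro k₁ k₂ k₃ h12 _ hp1 _
    simp only [meixnerProb, mxG_tsum] at hp1 ⊢
    have p := mxG_nonneg n m q hq0 i
    have hZ : 0 < ∑' h : {h : Fin n → ℕ // StrictMono h}, meixnerWeight n m q h.1 := by
      by_contra hcon
      exact absurd hp1 (not_lt.2 (div_nonpos_of_nonneg_of_nonpos (tsum_nonneg (p _))
        (not_lt.1 hcon)))
    have hS1 : ∑' h, mxG n m q i k₁ h ≠ 0 := by
      intro h0
      rw [h0, zero_div] at hp1
      exact lt_irrefl _ hp1
    obtain ⟨h, hh⟩ : ∃ h, mxG n m q i k₁ h ≠ 0 := by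
      by_contra! hcon
      apply hS1
      simp [hcon]
    have hh' : StrictMono h ∧ h i = k₁ := by
      by_contra hcon
      exact hh (if_neg hcon)
    have hmono : StrictMono (fun j => h j + (k₂ - k₁)) := fun a b hab =>
      Nat.add_lt_add_right (hh'.1 hab) _
    have hpos : 0 < mxG n m q i k₂ (fun j => h j + (k₂ - k₁)) := by
      unfold mxG
      rw [if_pos ⟨hmono, by show h i + (k₂ - k₁) = k₂; omega⟩]
      exact mx_pos n m hm q hq0 _ hmono
    exact div_pos ((mxG_summable n m hm q hq0 hq1 i k₂).tsum_pos (p _) _ hpos) hZ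
end
end

section
/- Let n ≥ 1 and α > 0. Under the Charlier ensemble P_{n,α,Ch}, i.e. the probability measure on {h ∈ ℕ^n : h_1 < ⋯ < h_n} with P(h) proportional to ∏_{1≤i<j≤n}(h_j − h_i)² · ∏_{j=1}^n α^{h_j}/h_j!, every one-dimensional marginal h_i has a log-concave distribution on ℕ: P(h_i = k−1)·P(h_i = k+1) ≤ P(h_i = k)² for all k ≥ 1. Moreover, the probability mass function of each h_i is ultra-log-concave. -/
open scoped BigOperators

noncomputable section

/-- Unnormalized Charlier weight of a configuration `h`:
`∏_{i<j} (h_j - h_i)² · ∏_j α^{h_j}/h_j!`. -/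
def charlierWeight (n : ℕ) (α : ℝ) (h : Fin n → ℕ) : ℝ :=
  (∏ i : Fin n, ∏ j : Fin n, if i < j then ((h j : ℝ) - (h i : ℝ)) ^ 2 else 1) *
    ∏ j : Fin n, α ^ (h j) / (Nat.factorial (h j) : ℝ)

/-- `P_{n,α,Ch}(h_i = k)`: the Charlier-ensemble probability that the `i`-th point
equals `k`. -/
def charlierProb (n : ℕ) (α : ℝ) (i : Fin n) (k : ℕ) : ℝ :=
  (∑' h : {h : Fin n → ℕ // StrictMono h ∧ h i = k}, charlierWeight n α h.1) /
    ∑' h : {h : Fin n → ℕ // StrictMono h}, charlierWeight n α h.1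

open scoped FinsetFamily

def chV (n : ℕ) (h : Fin n → ℕ) : ℝ :=
  ∏ i : Fin n, ∏ j : Fin n, if i < j then ((h j : ℝ) - (h i : ℝ)) ^ 2 else 1

def chU (n : ℕ) (α : ℝ) (i j : Fin n) (m : ℕ) : ℝ :=
  if j = i then α ^ m else α ^ m / (Nat.factorial m : ℝ)

def chG (n : ℕ) (α : ℝ) (i : Fin n) (h : Fin n → ℕ) : ℝ :=
  chV n h * ∏ j, chU n α i j (h j)

def chF (n : ℕ) (α : ℝ) (i : Fin n) (k : ℕ) : (Fin n → ℕ) → ℝ :=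
  Set.indicator {h | StrictMono h ∧ h i = k} (chG n α i)

def chFs (n : ℕ) (α : ℝ) (i : Fin n) (k : ℕ) (y : Fin n → ℕ) : ℝ :=
  if ∀ j, 1 ≤ y j then chF n α i k (fun j => y j - 1) else 0

theorem chV_nonneg (n : ℕ) (h : Fin n → ℕ) : 0 ≤ chV n h := by
  unfold chV
  refine Finset.prod_nonneg fun i _ => Finset.prod_nonneg fun j _ => ?_
  split_ifs <;> positivity

theorem chU_nonneg (n : ℕ) (α : ℝ) (hα : 0 < α) (i j : Fin n) (m : ℕ) : 0 ≤ chU n α i j m := by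
  unfold chU
  split_ifs <;> positivity

theorem chG_nonneg (n : ℕ) (α : ℝ) (hα : 0 < α) (i : Fin n) (h : Fin n → ℕ) :
    0 ≤ chG n α i h :=
  mul_nonneg (chV_nonneg n h) (Finset.prod_nonneg fun j _ => chU_nonneg n α hα i j _)

theorem chF_nonneg (n : ℕ) (α : ℝ) (hα : 0 < α) (i : Fin n) (k : ℕ) (h : Fin n → ℕ) :
    0 ≤ chF n α i k h :=
  Set.indicator_nonneg (fun x _ => chG_nonneg n α hα i x) h

theorem chFs_nonneg (n : ℕ) (α : ℝ) (hα : 0 < α) (i : Fin n) (k : ℕ) (h : Fin n → ℕ) :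
    0 ≤ chFs n α i k h := by
  unfold chFs
  split_ifs
  · exact chF_nonneg n α hα i k _
  · exact le_rfl

theorem chG_eq (n : ℕ) (α : ℝ) (i : Fin n) (h : Fin n → ℕ) :
    chG n α i h = (Nat.factorial (h i) : ℝ) * charlierWeight n α h := by
  have h1 : ∏ j, chU n α i j (h j)
      = (Nat.factorial (h i) : ℝ) * ∏ j, α ^ (h j) / (Nat.factorial (h j) : ℝ) := by
    rw [← Finset.mul_prod_erase Finset.univ _ (Finset.mem_univ i),
      ← Finset.mul_prod_erase Finset.univ (fun j => α ^ (h j) / (Nat.factorial (h j) : ℝ))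
        (Finset.mem_univ i), ← mul_assoc]
    congr 1
    · have : (Nat.factorial (h i) : ℝ) ≠ 0 := by positivity
      simp only [chU, if_true]
      field_simp
    · refine Finset.prod_congr rfl fun j hj => ?_
      simp [chU, Finset.ne_of_mem_erase hj]
  unfold chG charlierWeight
  rw [h1]
  unfold chV
  ring

theorem chU_ineq (n : ℕ) (α : ℝ) (hα : 0 < α) (i j : Fin n) (p q : ℕ) :
    chU n α i j p * chU n α i j q ≤ chU n α i j (min p (q + 1)) * chU n α i j (max p (q+1) - 1) := by
  rcases le_or_gt p (q+1) with h | h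
  · rw [min_eq_left h, max_eq_right h]
    simp
  · rw [min_eq_right h.le, max_eq_left h.le]
    obtain ⟨r, rfl⟩ : ∃ r, p = r + 1 := ⟨p - 1, by omega⟩
    simp only [Nat.add_sub_cancel]
    unfold chU
    split_ifs
    · apply le_of_eq; ring
    · rw [div_mul_div_comm, div_mul_div_comm]
      have e : α ^ (r+1) * α ^ q = α ^ (q+1) * α ^ r := by ring
      rw [e]
      apply div_le_div_of_nonneg_left (by positivity) (by positivity)
      rw [Nat.factorial_succ, Nat.factorial_succ]
      push_cast
      have : (q : ℝ) + 1 ≤ r + 1 := by exact_mod_cast h.le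
      have h0 : (0:ℝ) ≤ (Nat.factorial q : ℝ) * Nat.factorial r := by positivity
      nlinarith

theorem chD_ineq (a b c d : ℝ) (h1 : a ≤ b) (h2 : c ≤ d) :
    0 ≤ (b - a) * (d - c) ∧
    (b - a) * (d - c) ≤ (min b d - min a c) * (max b d - max a c) := by
  refine ⟨mul_nonneg (by linarith) (by linarith), ?_⟩
  rcases le_total a c with h | h <;> rcases le_total b d with h' | h' <;>
    simp only [h, h', min_eq_left, min_eq_right, max_eq_left, max_eq_right] <;>
    nlinarith [mul_nonneg (sub_nonneg.2 h) (sub_nonneg.2 h')]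

theorem chV_ineq (n : ℕ) (p q : Fin n → ℕ) (hp : StrictMono p) (hq : StrictMono q) :
    chV n p * chV n q ≤
      chV n (fun j => min (p j) (q j + 1)) * chV n (fun j => max (p j) (q j + 1) - 1) := by
  unfold chV
  rw [← Finset.prod_mul_distrib, ← Finset.prod_mul_distrib]
  simp_rw [← Finset.prod_mul_distrib]
  refine Finset.prod_le_prod (fun i _ => Finset.prod_nonneg fun j _ => ?_) fun i _ =>
    Finset.prod_le_prod (fun j _ => ?_) fun j _ => ?_
  · split_ifs <;> positivity
  · split_ifs <;> positivity
  · split_ifs with hij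
    · have h1 : ((p i : ℕ) : ℝ) ≤ p j := by exact_mod_cast (hp hij).le
      have h2 : ((q i : ℕ) : ℝ) + 1 ≤ q j + 1 := by
        have : ((q i : ℕ) : ℝ) ≤ q j := by exact_mod_cast (hq hij).le
        linarith
      obtain ⟨h3, h4⟩ := chD_ineq _ _ _ _ h1 h2
      have e : ∀ x : Fin n, ((max (p x) (q x + 1) - 1 : ℕ) : ℝ) = max (p x : ℝ) (q x + 1) - 1 := by
        intro x
        rw [Nat.cast_sub (by simp)]
        push_cast
        rfl
      rw [e, e, ← mul_pow, ← mul_pow]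
      push_cast
      apply pow_le_pow_left₀
      · have h3' := h3
        ring_nf at h3' ⊢
        exact h3'
      · have h4' := h4
        rw [show (q j : ℝ) - q i = (q j + 1) - (q i + 1) by ring]
        refine h4'.trans (le_of_eq ?_)
        ring
    · simp

theorem chF_ineq (n : ℕ) (α : ℝ) (hα : 0 < α) (i : Fin n) (k : ℕ) (x y : Fin n → ℕ) :
    chF n α i (k+2) x * chFs n α i k y ≤ chF n α i (k+1) (x ⊓ y) * chFs n α i (k+1) (x ⊔ y) := by
  have hR : 0 ≤ chF n α i (k+1) (x ⊓ y) * chFs n α i (k+1) (x ⊔ y) :=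
    mul_nonneg (chF_nonneg n α hα _ _ _) (chFs_nonneg n α hα _ _ _)
  by_cases hx : StrictMono x ∧ x i = k + 2
  swap
  · have : chF n α i (k+2) x = 0 := Set.indicator_of_notMem (s := {h : Fin n → ℕ | StrictMono h ∧ h i = k + 2}) hx _
    rw [this, zero_mul]; exact hR
  by_cases hy1 : ∀ j, 1 ≤ y j
  swap
  · have : chFs n α i k y = 0 := if_neg hy1
    rw [this, mul_zero]; exact hR
  obtain ⟨q, rfl⟩ : ∃ q : Fin n → ℕ, y = fun j => q j + 1 :=
    ⟨fun j => y j - 1, funext fun j => by have := hy1 j; simp only; omega⟩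
  have e1 : chFs n α i k (fun j => q j + 1) = chF n α i k q := by
    unfold chFs
    rw [if_pos hy1]; simp
  by_cases hq : StrictMono q ∧ q i = k
  swap
  · have : chF n α i k q = 0 := Set.indicator_of_notMem (s := {h : Fin n → ℕ | StrictMono h ∧ h i = k}) hq _
    rw [e1, this, mul_zero]; exact hR
  have e2 : chF n α i (k+1) (x ⊓ fun j => q j + 1) = chG n α i (fun j => min (x j) (q j + 1)) := by
    apply Set.indicator_of_mem
    refine ⟨fun a b hab => ?_, ?_⟩
    · have := hx.1 hab; have := hq.1 hab
      simp only [Pi.inf_apply]; omega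
    · simp only [Pi.inf_apply]; omega
  have e3 : chFs n α i (k+1) (x ⊔ fun j => q j + 1)
      = chG n α i (fun j => max (x j) (q j + 1) - 1) := by
    unfold chFs
    rw [if_pos (fun j => by simp only [Pi.sup_apply]; omega)]
    apply Set.indicator_of_mem
    refine ⟨fun a b hab => ?_, ?_⟩
    · have := hx.1 hab; have := hq.1 hab
      simp only [Pi.sup_apply]; omega
    · simp only [Pi.sup_apply]; omega
  have e4 : chF n α i (k+2) x = chG n α i x := Set.indicator_of_mem (s := {h : Fin n → ℕ | StrictMono h ∧ h i = k + 2}) hx _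
  have e5 : chF n α i k q = chG n α i q := Set.indicator_of_mem (s := {h : Fin n → ℕ | StrictMono h ∧ h i = k}) hq _
  rw [e1, e2, e3, e4, e5]
  unfold chG
  rw [mul_mul_mul_comm, mul_mul_mul_comm (chV n fun j => min (x j) (q j + 1)),
    ← Finset.prod_mul_distrib, ← Finset.prod_mul_distrib]
  refine mul_le_mul (chV_ineq n x q hx.1 hq.1) ?_ ?_ ?_
  · exact Finset.prod_le_prod
      (fun j _ => mul_nonneg (chU_nonneg n α hα _ _ _) (chU_nonneg n α hα _ _ _))
      fun j _ => chU_ineq n α hα i j _ _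
  · exact Finset.prod_nonneg
      (fun j _ => mul_nonneg (chU_nonneg n α hα _ _ _) (chU_nonneg n α hα _ _ _))
  · exact mul_nonneg (chV_nonneg _ _) (chV_nonneg _ _)

theorem chF_tsum_ineq (n : ℕ) (α : ℝ) (hα : 0 < α) (i : Fin n)
    (hs : ∀ k, Summable (chF n α i k)) (k : ℕ) :
    (∑' h, chF n α i (k+2) h) * (∑' h, chF n α i k h) ≤ (∑' h, chF n α i (k+1) h) ^ 2 := by
  refine le_of_tendsto' (Filter.Tendsto.mul (hs (k+2)).hasSum (hs k).hasSum) fun s => ?_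
  have inj : Function.Injective (fun (q : Fin n → ℕ) (j : Fin n) => q j + 1) := by
    intro a b hab
    funext j
    have := congrFun hab j
    simpa using this
  have e : ∑ h ∈ s, chF n α i k h
      = ∑ y ∈ s.image (fun (q : Fin n → ℕ) (j : Fin n) => q j + 1), chFs n α i k y := by
    rw [Finset.sum_image (fun a _ b _ h => inj h)]
    refine Finset.sum_congr rfl fun q _ => ?_
    unfold chFs
    rw [if_pos (fun j => Nat.le_add_left 1 (q j))]
    simp
  have h4 : ∀ T : Finset (Fin n → ℕ), ∑ y ∈ T, chFs n α i (k+1) y ≤ ∑' h, chF n α i (k+1) h := by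
    intro T
    unfold chFs
    rw [← Finset.sum_filter]
    have injT : Set.InjOn (fun (q : Fin n → ℕ) (j : Fin n) => q j - 1)
        (T.filter fun y => ∀ j, 1 ≤ y j : Finset (Fin n → ℕ)) := by
      intro a ha b hb hab
      simp only [Finset.coe_filter, Set.mem_ofPred_eq] at ha hb
      funext j
      have h1 := congrFun hab j
      have h2 := ha.2 j
      have h3 := hb.2 j
      simp only at h1
      omega
    rw [← Finset.sum_image (f := chF n α i (k+1)) injT]
    exact (hs (k+1)).sum_le_tsum _ (fun h _ => chF_nonneg n α hα i _ h)
  have key := four_functions_theorem (β := ℝ) (f₁ := chF n α i (k+2)) (f₂ := chFs n α i k)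
    (f₃ := chF n α i (k+1)) (f₄ := chFs n α i (k+1))
    (fun h => chF_nonneg n α hα i _ h) (fun h => chFs_nonneg n α hα i _ h)
    (fun h => chF_nonneg n α hα i _ h) (fun h => chFs_nonneg n α hα i _ h)
    (fun a b => chF_ineq n α hα i k a b) s
    (s.image (fun (q : Fin n → ℕ) (j : Fin n) => q j + 1))
  rw [← e] at key
  refine key.trans ?_
  rw [sq]
  exact mul_le_mul ((hs (k+1)).sum_le_tsum _ (fun h _ => chF_nonneg n α hα i _ h)) (h4 _)
    (Finset.sum_nonneg fun h _ => chFs_nonneg n α hα i _ h)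
    (tsum_nonneg fun h => chF_nonneg n α hα i _ h)

theorem chF_tsum_eq (n : ℕ) (α : ℝ) (i : Fin n) (k : ℕ) :
    ∑' h, chF n α i k h = (Nat.factorial k : ℝ) *
      ∑' h : {h : Fin n → ℕ // StrictMono h ∧ h i = k}, charlierWeight n α h.1 := by
  rw [← tsum_mul_left]
  unfold chF
  rw [← tsum_subtype]
  refine tsum_congr fun h => ?_
  rw [chG_eq]
  have : h.1 i = k := h.2.2
  rw [this]

theorem charlierWeight_nonneg (n : ℕ) (α : ℝ) (hα : 0 < α) (h : Fin n → ℕ) :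
    0 ≤ charlierWeight n α h := by
  have := chV_nonneg n h
  unfold chV at this
  exact mul_nonneg this (Finset.prod_nonneg fun j _ => by positivity)

theorem charlierWeight_pos (n : ℕ) (α : ℝ) (hα : 0 < α) (h : Fin n → ℕ) (hh : StrictMono h) :
    0 < charlierWeight n α h := by
  refine mul_pos (Finset.prod_pos fun i _ => Finset.prod_pos fun j _ => ?_)
    (Finset.prod_pos fun j _ => by positivity)
  split_ifs with hij
  · have : ((h i : ℕ) : ℝ) < h j := by exact_mod_cast hh hij
    exact pow_pos (by linarith) 2
  · exact one_pos

theorem ch_summable_aux {T : Type} (f : T → ℝ) (P Q : T → Prop) (hPQ : ∀ x, Q x → P x)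
    (hs : Summable fun h : {h : T // P h} => f h.1) : Summable fun h : {h : T // Q h} => f h.1 := by
  have he : Function.Injective (fun h : {h : T // Q h} => (⟨h.1, hPQ _ h.2⟩ : {h : T // P h})) := by
    intro a b hab
    have := congrArg Subtype.val hab
    exact Subtype.ext this
  exact hs.comp_injective he

theorem ch_summable_sub (n : ℕ) (α : ℝ) (i : Fin n) (k : ℕ)
    (hs : Summable fun h : {h : Fin n → ℕ // StrictMono h} => charlierWeight n α h.1) :
    Summable fun h : {h : Fin n → ℕ // StrictMono h ∧ h i = k} => charlierWeight n α h.1 := by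
  exact ch_summable_aux _ _ _ (fun _ h => h.1) hs

theorem chF_summable (n : ℕ) (α : ℝ) (i : Fin n) (k : ℕ)
    (hs : Summable fun h : {h : Fin n → ℕ // StrictMono h} => charlierWeight n α h.1) :
    Summable (chF n α i k) := by
  unfold chF
  rw [← summable_subtype_iff_indicator]
  refine ((ch_summable_sub n α i k hs).mul_left (Nat.factorial k : ℝ)).congr fun h => ?_
  simp only [Function.comp]
  rw [chG_eq]
  have : h.1 i = k := h.2.2
  rw [this]

theorem charlierProb_nonneg (n : ℕ) (α : ℝ) (hα : 0 < α) (i : Fin n) (k : ℕ) :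
    0 ≤ charlierProb n α i k :=
  div_nonneg (tsum_nonneg fun h => charlierWeight_nonneg n α hα _)
    (tsum_nonneg fun h => charlierWeight_nonneg n α hα _)

theorem charlier_ulc (n : ℕ) (α : ℝ) (hα : 0 < α) (i : Fin n) (k : ℕ) :
    ((Nat.factorial k : ℝ) * charlierProb n α i k) *
          ((Nat.factorial (k + 2) : ℝ) * charlierProb n α i (k + 2)) ≤
        ((Nat.factorial (k + 1) : ℝ) * charlierProb n α i (k + 1)) ^ 2 := by
  by_cases hs : Summable fun h : {h : Fin n → ℕ // StrictMono h} => charlierWeight n α h.1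
  · have := chF_tsum_ineq n α hα i (fun k => chF_summable n α i k hs) k
    rw [chF_tsum_eq, chF_tsum_eq, chF_tsum_eq] at this
    unfold charlierProb
    simp only [← mul_div_assoc (Nat.factorial _ : ℝ)]
    rw [div_mul_div_comm, div_pow, ← sq]
    refine div_le_div_of_nonneg_right ?_ (sq_nonneg _)
    rw [mul_comm]
    exact this
  · unfold charlierProb
    rw [tsum_eq_zero_of_not_summable hs]
    simp

/-- Every one-dimensional marginal of the Charlier ensemble (parameters `n ≥ 1`,
`α > 0`) has a log-concave distribution on ℕ (log-concavity inequality for all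
`k ≥ 1`, no internal zeros); moreover its pmf is ultra-log-concave, i.e.
`k ↦ k!·P(h_i = k)` is log-concave. -/
theorem logConcave_ultraLogConcave_marginal_charlier (n : ℕ) (hn : 1 ≤ n)
    (α : ℝ) (hα : 0 < α) :
    ∀ i : Fin n,
      (∀ k : ℕ, 1 ≤ k →
        charlierProb n α i (k - 1) * charlierProb n α i (k + 1) ≤
          (charlierProb n α i k) ^ 2) ∧
      (∀ k₁ k₂ k₃ : ℕ, k₁ ≤ k₂ → k₂ ≤ k₃ →
        0 < charlierProb n α i k₁ → 0 < charlierProb n α i k₃ →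
        0 < charlierProb n α i k₂) ∧
      (∀ k : ℕ,
        ((Nat.factorial k : ℝ) * charlierProb n α i k) *
          ((Nat.factorial (k + 2) : ℝ) * charlierProb n α i (k + 2)) ≤
        ((Nat.factorial (k + 1) : ℝ) * charlierProb n α i (k + 1)) ^ 2) := by
  intro i
  refine ⟨?_, ?_, charlier_ulc n α hα i⟩
  · intro k hk
    obtain ⟨m, rfl⟩ : ∃ m, k = m + 1 := ⟨k - 1, by omega⟩
    have h := charlier_ulc n α hα i m
    simp only [Nat.add_sub_cancel]
    have p0 := charlierProb_nonneg n α hα i m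
    have p2 := charlierProb_nonneg n α hα i (m + 2)
    rw [Nat.factorial_succ (m + 1), Nat.factorial_succ m] at h
    push_cast at h
    have hf : (0 : ℝ) < (Nat.factorial m : ℝ) := by positivity
    have hm : (0 : ℝ) ≤ (m : ℝ) := by positivity
    have hc : (0 : ℝ) < (Nat.factorial m : ℝ) ^ 2 * (m + 1) ^ 2 := by positivity
    refine le_of_mul_le_mul_left ?_ hc
    have hx : 0 ≤ (Nat.factorial m : ℝ) ^ 2 * (m + 1) *
        (charlierProb n α i m * charlierProb n α i (m + 2)) := by positivity
    change _ * (_ * charlierProb n α i (m + 2)) ≤ _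
    nlinarith
  · intro k₁ k₂ k₃ h12 _ h1 _
    have hs : Summable fun h : {h : Fin n → ℕ // StrictMono h} => charlierWeight n α h.1 := by
      by_contra hs
      unfold charlierProb at h1
      rw [tsum_eq_zero_of_not_summable hs] at h1
      simp at h1
    obtain ⟨g, hg⟩ : ∃ g : Fin n → ℕ, StrictMono g ∧ g i = k₁ := by
      by_contra hne
      have : IsEmpty {h : Fin n → ℕ // StrictMono h ∧ h i = k₁} := ⟨fun x => hne ⟨x.1, x.2⟩⟩
      unfold charlierProb at h1
      simp at h1
    have hg2 : StrictMono (fun j => g j + (k₂ - k₁)) ∧ g i + (k₂ - k₁) = k₂ :=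
      ⟨fun a b hab => by have := hg.1 hab; simp only; omega, by have := hg.2; omega⟩
    unfold charlierProb
    refine div_pos ?_ ?_
    · exact (ch_summable_sub n α i k₂ hs).tsum_pos
        (fun h => charlierWeight_nonneg n α hα _) ⟨_, hg2⟩ (charlierWeight_pos n α hα _ hg2.1)
    · exact hs.tsum_pos
        (fun h => charlierWeight_nonneg n α hα _) ⟨g, hg.1⟩ (charlierWeight_pos n α hα _ hg.1)
end
end

section
/- Let K ≥ n ≥ 1 be integers and p ∈ (0,1), q = 1−p. Under the Krawtchouk ensemble P_{n,K,p,Kr}, i.e. the probability measure on {h ∈ {0,1,…,K}^n : h_1 < ⋯ < h_n} with P(h) proportional to ∏_{1≤i<j≤n}(h_j − h_i)² · ∏_{j=1}^n binom(K, h_j) p^{h_j} q^{K−h_j}, every one-dimensional marginal h_i has a log-concave distribution: P(h_i = k−1)·P(h_i = k+1) ≤ P(h_i = k)² for all k. Moreover, the probability mass function of each h_i is ultra-log-concave. -/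
open scoped BigOperators

noncomputable section

/-- Unnormalized Krawtchouk weight of a configuration `h`:
`∏_{i<j} (h_j - h_i)² · ∏_j binom(K, h_j) p^{h_j} q^{K - h_j}` with `q = 1 - p`. -/
def krawtchoukWeight (n K : ℕ) (p : ℝ) (h : Fin n → ℕ) : ℝ :=
  (∏ i : Fin n, ∏ j : Fin n, if i < j then ((h j : ℝ) - (h i : ℝ)) ^ 2 else 1) *
    ∏ j : Fin n, (Nat.choose K (h j) : ℝ) * p ^ (h j) * (1 - p) ^ (K - h j)

/-- `P_{n,K,p,Kr}(h_i = k)`: the Krawtchouk-ensemble probability that the `i`-th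
point equals `k` (the configuration being constrained to `{0,…,K}`). -/
def krawtchoukProb (n K : ℕ) (p : ℝ) (i : Fin n) (k : ℕ) : ℝ :=
  (∑' h : {h : Fin n → ℕ // StrictMono h ∧ (∀ j, h j ≤ K) ∧ h i = k},
      krawtchoukWeight n K p h.1) /
    ∑' h : {h : Fin n → ℕ // StrictMono h ∧ ∀ j, h j ≤ K}, krawtchoukWeight n K p h.1

open Finset in
/-- configurations with `h i = k` -/
def kconf (n K : ℕ) (i : Fin n) (k : ℕ) : Finset (Fin n → ℕ) := by
  classical
  exact (Fintype.piFinset fun _ : Fin n => Finset.range (K + 1)).filter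
    (fun h => StrictMono h ∧ h i = k)

lemma mem_kconf {n K : ℕ} {i : Fin n} {k : ℕ} {h : Fin n → ℕ} :
    h ∈ kconf n K i k ↔ (StrictMono h ∧ (∀ j, h j ≤ K) ∧ h i = k) := by
  classical
  simp only [kconf, Finset.mem_filter, Fintype.mem_piFinset, Finset.mem_range, Nat.lt_succ_iff]
  tauto

lemma kW_nonneg (n K : ℕ) (p : ℝ) (hp0 : 0 < p) (hp1 : p < 1) (h : Fin n → ℕ) :
    0 ≤ krawtchoukWeight n K p h := by
  have : 0 < 1 - p := by linarith
  unfold krawtchoukWeight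
  refine mul_nonneg (Finset.prod_nonneg fun i _ => Finset.prod_nonneg fun j _ => ?_)
    (Finset.prod_nonneg fun j _ => by positivity)
  split_ifs <;> positivity

lemma kW_pos (n K : ℕ) (p : ℝ) (hp0 : 0 < p) (hp1 : p < 1) (h : Fin n → ℕ)
    (hm : StrictMono h) (hK : ∀ j, h j ≤ K) :
    0 < krawtchoukWeight n K p h := by
  have : 0 < 1 - p := by linarith
  unfold krawtchoukWeight
  refine mul_pos (Finset.prod_pos fun i _ => Finset.prod_pos fun j _ => ?_)
    (Finset.prod_pos fun j _ => ?_)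
  · split_ifs with hij
    · have : (h i : ℝ) < h j := by exact_mod_cast hm hij
      have : (0 : ℝ) < h j - h i := by linarith
      positivity
    · positivity
  · have := Nat.choose_pos (hK j)
    positivity

lemma kprob_eq (n K : ℕ) (p : ℝ) (i : Fin n) (k : ℕ) :
    krawtchoukProb n K p i k = (∑ h ∈ kconf n K i k, krawtchoukWeight n K p h) /
      ∑' h : {h : Fin n → ℕ // StrictMono h ∧ ∀ j, h j ≤ K}, krawtchoukWeight n K p h.1 := by
  unfold krawtchoukProb
  congr 1
  rw [← Finset.tsum_subtype]
  exact (Equiv.subtypeEquivRight fun h => mem_kconf.symm).tsum_eq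
    (fun h : {h // h ∈ kconf n K i k} => krawtchoukWeight n K p h.1)

/-- one-point weight -/
def kw1 (K : ℕ) (p : ℝ) (m : ℕ) : ℝ := (Nat.choose K m : ℝ) * p ^ m * (1 - p) ^ (K - m)

lemma kw1_nonneg (K : ℕ) (p : ℝ) (hp0 : 0 < p) (hp1 : p < 1) (m : ℕ) : 0 ≤ kw1 K p m := by
  have : 0 < 1 - p := by linarith
  unfold kw1; positivity

lemma desc_lc (K a b : ℕ) (hab : a ≤ b) :
    K.descFactorial a * K.descFactorial (b + 1) ≤ K.descFactorial (a + 1) * K.descFactorial b := by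
  rw [Nat.descFactorial_succ, Nat.descFactorial_succ]
  have : K - b ≤ K - a := by omega
  calc _ = (K - b) * (K.descFactorial a * K.descFactorial b) := by ring
    _ ≤ (K - a) * (K.descFactorial a * K.descFactorial b) := Nat.mul_le_mul_right _ this
    _ = _ := by ring

lemma choose_lc (K a b : ℕ) (hab : a ≤ b) :
    K.choose a * K.choose (b + 1) ≤ K.choose (a + 1) * K.choose b := by
  have h := desc_lc K a b hab
  simp only [Nat.descFactorial_eq_factorial_mul_choose, Nat.factorial_succ] at h
  have hpos : 0 < (a.factorial * b.factorial) * (b + 1) := by positivity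
  refine Nat.le_of_mul_le_mul_left ?_ hpos
  calc _ = (a.factorial * K.choose a) * ((b + 1) * b.factorial * K.choose (b + 1)) := by ring
    _ ≤ _ := h
    _ = (a.factorial * b.factorial * (K.choose (a+1) * K.choose b)) * (a + 1) := by ring
    _ ≤ (a.factorial * b.factorial * (K.choose (a+1) * K.choose b)) * (b + 1) :=
        Nat.mul_le_mul_left _ (by omega)
    _ = _ := by ring

lemma kw1_lc (K : ℕ) (p : ℝ) (hp0 : 0 < p) (hp1 : p < 1) (a b : ℕ) (hab : a ≤ b)
    (F : ℕ → ℝ) (hF : ∀ m, 0 ≤ F m)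
    (h : (F a * K.choose a) * (F (b + 1) * K.choose (b + 1)) ≤
      (F (a + 1) * K.choose (a + 1)) * (F b * K.choose b)) :
    (F a * kw1 K p a) * (F (b + 1) * kw1 K p (b + 1)) ≤
      (F (a + 1) * kw1 K p (a + 1)) * (F b * kw1 K p b) := by
  have hq : 0 < 1 - p := by linarith
  by_cases hb : b + 1 ≤ K
  · unfold kw1
    obtain ⟨c, rfl⟩ := Nat.exists_eq_add_of_le hb
    obtain ⟨d, rfl⟩ := Nat.exists_eq_add_of_le hab
    have e1 : a + d + 1 + c - a = d + 1 + c := by omega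
    have e2 : a + d + 1 + c - (a + d + 1) = c := by omega
    have e3 : a + d + 1 + c - (a + 1) = d + c := by omega
    have e4 : a + d + 1 + c - (a + d) = 1 + c := by omega
    rw [e1, e2, e3, e4]
    have := mul_le_mul_of_nonneg_right h
      (show 0 ≤ p ^ (a + (a + d + 1)) * (1 - p) ^ (d + 1 + c + c) by positivity)
    calc _ = _ := by ring
      _ ≤ _ := this
      _ = _ := by ring
  · have : kw1 K p (b + 1) = 0 := by
      unfold kw1; rw [Nat.choose_eq_zero_of_lt (by omega)]; simp
    rw [this]
    have := kw1_nonneg K p hp0 hp1 (a + 1)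
    have := kw1_nonneg K p hp0 hp1 b
    have := hF (a + 1)
    have := hF b
    simp only [mul_zero]
    positivity

lemma pair_ineq_s7 (a1 a2 b1 b2 : ℝ) (ha : a1 < a2) (hb : b1 < b2) :
    (a2 - a1) ^ 2 * (b2 - b1) ^ 2 ≤
    (min (a2 + 1) b2 - min (a1 + 1) b1) ^ 2 * (max (a2 + 1) b2 - 1 - (max (a1 + 1) b1 - 1)) ^ 2 := by
  rw [← mul_pow, ← mul_pow]
  have h0 : 0 ≤ (a2 - a1) * (b2 - b1) := mul_nonneg (by linarith) (by linarith)
  refine pow_le_pow_left₀ h0 ?_ 2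
  rcases le_total (a2 + 1) b2 with h2 | h2 <;> rcases le_total (a1 + 1) b1 with h1 | h1 <;>
    simp only [min_eq_left, max_eq_right, min_eq_right, max_eq_left, h1, h2]
  · nlinarith
  · nlinarith [mul_nonneg (sub_nonneg.2 h2) (sub_nonneg.2 h1)]
  · nlinarith [mul_nonneg (sub_nonneg.2 h2) (sub_nonneg.2 h1)]
  · nlinarith

/-- factor at coordinate `j` -/
def kF (n : ℕ) (i j : Fin n) (m : ℕ) : ℝ := if j = i then (m.factorial : ℝ) else 1

/-- `W h * (h i)!` in product form -/
lemma kW_fact (n K : ℕ) (p : ℝ) (i : Fin n) (h : Fin n → ℕ) :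
    krawtchoukWeight n K p h * ((h i).factorial : ℝ) =
    (∏ i : Fin n, ∏ j : Fin n, if i < j then ((h j : ℝ) - (h i : ℝ)) ^ 2 else 1) *
      ∏ j : Fin n, kF n i j (h j) * kw1 K p (h j) := by
  unfold krawtchoukWeight
  have e : ∏ j : Fin n, kF n i j (h j) * kw1 K p (h j) =
    (∏ j : Fin n, kF n i j (h j)) * ∏ j : Fin n, kw1 K p (h j) := Finset.prod_mul_distrib
  rw [e]
  have : ∏ j : Fin n, kF n i j (h j) = ((h i).factorial : ℝ) := by
    unfold kF
    rw [Finset.prod_ite_eq' Finset.univ i (fun j => ((h j).factorial : ℝ))]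
    simp
  rw [this]
  unfold kw1
  ring

lemma kF_lc (n K : ℕ) (p : ℝ) (hp0 : 0 < p) (hp1 : p < 1) (i j : Fin n) (a b : ℕ) (hab : a ≤ b) :
    (kF n i j a * kw1 K p a) * (kF n i j (b + 1) * kw1 K p (b + 1)) ≤
      (kF n i j (a + 1) * kw1 K p (a + 1)) * (kF n i j b * kw1 K p b) := by
  apply kw1_lc K p hp0 hp1 a b hab
  · intro m; unfold kF; split_ifs <;> positivity
  · unfold kF
    split_ifs
    · have := desc_lc K a b hab
      simp only [Nat.descFactorial_eq_factorial_mul_choose] at this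
      exact_mod_cast this
    · simp only [one_mul]
      exact_mod_cast choose_lc K a b hab

lemma mul4_le {A B C D A' B' C' D' : ℝ} (h1 : A * C ≤ A' * C') (h2 : B * D ≤ B' * D')
    (h3 : 0 ≤ B * D) (h4 : 0 ≤ A' * C') : A * B * (C * D) ≤ A' * B' * (C' * D') := by
  rw [mul_mul_mul_comm, mul_mul_mul_comm A']
  exact mul_le_mul h1 h2 h3 h4

lemma kV_ineq (n K : ℕ) (p : ℝ) (hp0 : 0 < p) (hp1 : p < 1) (i : Fin n) (x y : Fin n → ℕ)
    (hx : StrictMono x) (hy : StrictMono y) :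
    (krawtchoukWeight n K p x * ((x i).factorial : ℝ)) *
      (krawtchoukWeight n K p y * ((y i).factorial : ℝ)) ≤
    (krawtchoukWeight n K p (fun j => min (x j + 1) (y j)) *
      ((min (x i + 1) (y i)).factorial : ℝ)) *
    (krawtchoukWeight n K p (fun j => max (x j + 1) (y j) - 1) *
      ((max (x i + 1) (y i) - 1).factorial : ℝ)) := by
  have e1 := kW_fact n K p i (fun j => min (x j + 1) (y j))
  have e2 := kW_fact n K p i (fun j => max (x j + 1) (y j) - 1)
  rw [e1, e2, kW_fact, kW_fact]
  have hnn : ∀ j m, 0 ≤ kF n i j m * kw1 K p m := by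
    intro j m
    refine mul_nonneg ?_ (kw1_nonneg K p hp0 hp1 m)
    unfold kF; split_ifs <;> positivity
  have hA : ∀ (h : Fin n → ℕ) (a b : Fin n),
    (0 : ℝ) ≤ if a < b then ((h b : ℝ) - (h a : ℝ)) ^ 2 else 1 := by
    intro h a b; split_ifs <;> positivity
  refine mul4_le ?_ ?_ ?_ ?_
  · simp only [← Finset.prod_mul_distrib]
    refine Finset.prod_le_prod (fun a _ => Finset.prod_nonneg fun b _ =>
      mul_nonneg (hA x a b) (hA y a b)) fun a _ => Finset.prod_le_prod (fun b _ =>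
      mul_nonneg (hA x a b) (hA y a b)) fun b _ => ?_
    split_ifs with hab
    · have := pair_ineq_s7 (x a) (x b) (y a) (y b) (by exact_mod_cast hx hab)
        (by exact_mod_cast hy hab)
      have c : ∀ j, ((max (x j + 1) (y j) - 1 : ℕ) : ℝ) = max ((x j : ℝ) + 1) (y j) - 1 := by
        intro j
        rw [Nat.cast_sub (by omega)]
        push_cast; rfl
      rw [c, c]
      push_cast
      exact this
    · simp
  · simp only [← Finset.prod_mul_distrib]
    refine Finset.prod_le_prod (fun j _ => mul_nonneg (hnn _ _) (hnn _ _)) fun j _ => ?_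
    rcases Nat.lt_or_ge (x j) (y j) with hxy | hxy
    · obtain ⟨b, hb⟩ : ∃ b, y j = b + 1 := ⟨y j - 1, by omega⟩
      have := kF_lc n K p hp0 hp1 i j (x j) b (by omega)
      rw [hb, min_eq_left (by omega), max_eq_right (by omega)]
      exact this
    · rw [min_eq_right (by omega), max_eq_left (by omega), Nat.add_sub_cancel, mul_comm]
  · exact mul_nonneg (Finset.prod_nonneg fun j _ => hnn _ _) (Finset.prod_nonneg fun j _ => hnn _ _)
  · exact mul_nonneg
      (Finset.prod_nonneg fun a _ => Finset.prod_nonneg fun b _ =>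
        hA (fun j => min (x j + 1) (y j)) a b)
      (Finset.prod_nonneg fun a _ => Finset.prod_nonneg fun b _ =>
        hA (fun j => max (x j + 1) (y j) - 1) a b)

open scoped FinsetFamily in
lemma main_ineq (n K : ℕ) (p : ℝ) (hp0 : 0 < p) (hp1 : p < 1) (i : Fin n) (k : ℕ) :
    (∑ h ∈ kconf n K i k, krawtchoukWeight n K p h * ((h i).factorial : ℝ)) *
    (∑ h ∈ kconf n K i (k + 2), krawtchoukWeight n K p h * ((h i).factorial : ℝ)) ≤
    (∑ h ∈ kconf n K i (k + 1), krawtchoukWeight n K p h * ((h i).factorial : ℝ)) ^ 2 := by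
  classical
  set V : (Fin n → ℕ) → ℝ := fun h => krawtchoukWeight n K p h * ((h i).factorial : ℝ) with hV
  have hVn : ∀ h, 0 ≤ V h := fun h =>
    mul_nonneg (kW_nonneg n K p hp0 hp1 h) (by positivity)
  let up : (Fin n → ℕ) → (Fin n → ℕ) := fun h j => h j + 1
  let dn : (Fin n → ℕ) → (Fin n → ℕ) := fun h j => h j - 1
  have du : ∀ h, dn (up h) = h := fun h => by funext j; simp [up, dn]
  have upinj : Function.Injective up := Function.LeftInverse.injective du
  let s := (kconf n K i k).image up
  let t := kconf n K i (k + 2)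
  let s' := (kconf n K i (k + 1)).image up
  let t' := kconf n K i (k + 1)
  have key : ∀ x ∈ kconf n K i k, ∀ y ∈ t, up x ⊓ y ∈ t' ∧ up x ⊔ y ∈ s' := by
    intro x hx y hy
    obtain ⟨hx1, hx2, hx3⟩ := mem_kconf.1 hx
    obtain ⟨hy1, hy2, hy3⟩ := mem_kconf.1 hy
    refine ⟨mem_kconf.2 ⟨?_, ?_, ?_⟩, Finset.mem_image.2 ⟨dn (up x ⊔ y), mem_kconf.2 ⟨?_, ?_, ?_⟩, ?_⟩⟩
    · intro a b hab
      have := hx1 hab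
      have := hy1 hab
      simp only [Pi.inf_apply, up]; omega
    · intro j
      have := hy2 j
      simp only [Pi.inf_apply, up]; omega
    · simp only [Pi.inf_apply, up]; omega
    · intro a b hab
      have := hx1 hab
      have := hy1 hab
      simp only [Pi.sup_apply, up, dn]; omega
    · intro j
      have := hy2 j
      have := hx2 j
      simp only [Pi.sup_apply, up, dn]; omega
    · simp only [Pi.sup_apply, up, dn]; omega
    · funext j
      simp only [Pi.sup_apply, up, dn]; omega
  let f1 : (Fin n → ℕ) → ℝ := fun z => if z ∈ s then V (dn z) else 0
  let f2 : (Fin n → ℕ) → ℝ := fun z => if z ∈ t then V z else 0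
  let f3 : (Fin n → ℕ) → ℝ := V
  let f4 : (Fin n → ℕ) → ℝ := fun z => V (dn z)
  have h1 : 0 ≤ f1 := fun z => by simp only [f1]; split_ifs <;> simp [hVn]
  have h2 : 0 ≤ f2 := fun z => by simp only [f2]; split_ifs <;> simp [hVn]
  have h3 : 0 ≤ f3 := fun z => hVn z
  have h4 : 0 ≤ f4 := fun z => hVn _
  have hh : ∀ a b, f1 a * f2 b ≤ f3 (a ⊓ b) * f4 (a ⊔ b) := by
    intro a b
    by_cases ha : a ∈ s
    · by_cases hb : b ∈ t
      · obtain ⟨x, hx, rfl⟩ := Finset.mem_image.1 ha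
        simp only [f1, f2, if_pos ha, if_pos hb, du]
        exact kV_ineq n K p hp0 hp1 i x b (mem_kconf.1 hx).1 (mem_kconf.1 hb).1
      · simp only [f2, if_neg hb, mul_zero]
        exact mul_nonneg (h3 _) (h4 _)
    · simp only [f1, if_neg ha, zero_mul]
      exact mul_nonneg (h3 _) (h4 _)
  have four := four_functions_theorem f1 f2 f3 f4 h1 h2 h3 h4 hh s t
  have i1 : ∑ a ∈ s, f1 a = ∑ h ∈ kconf n K i k, V h := by
    rw [Finset.sum_congr rfl (g := fun z => V (dn z)) (fun z hz => by simp only [f1, if_pos hz])]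
    rw [Finset.sum_image (fun a _ b _ h => upinj h)]
    simp only [du]
  have i2 : ∑ a ∈ t, f2 a = ∑ h ∈ t, V h :=
    Finset.sum_congr rfl (fun z hz => by simp only [f2, if_pos hz])
  have i3 : ∑ a ∈ s ⊼ t, f3 a ≤ ∑ h ∈ t', V h := by
    refine Finset.sum_le_sum_of_subset_of_nonneg ?_ (fun z _ _ => hVn z)
    intro z hz
    obtain ⟨a, ha, b, hb, rfl⟩ := Finset.mem_infs.1 hz
    obtain ⟨x, hx, rfl⟩ := Finset.mem_image.1 ha
    exact (key x hx b hb).1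
  have i4 : ∑ a ∈ s ⊻ t, f4 a ≤ ∑ h ∈ t', V h := by
    calc _ ≤ ∑ a ∈ s', f4 a := by
          refine Finset.sum_le_sum_of_subset_of_nonneg ?_ (fun z _ _ => h4 z)
          intro z hz
          obtain ⟨a, ha, b, hb, rfl⟩ := Finset.mem_sups.1 hz
          obtain ⟨x, hx, rfl⟩ := Finset.mem_image.1 ha
          exact (key x hx b hb).2
      _ = _ := by
          rw [Finset.sum_image (fun a _ b _ h => upinj h)]
          simp only [f4, du]; rfl
  rw [i1, i2] at four
  refine four.trans ?_
  rw [pow_two]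
  exact mul_le_mul i3 i4 (Finset.sum_nonneg fun z _ => h4 z) (Finset.sum_nonneg fun z _ => hVn z)

lemma kprob_fact (n K : ℕ) (p : ℝ) (i : Fin n) (k : ℕ) :
    (Nat.factorial k : ℝ) * krawtchoukProb n K p i k =
    (∑ h ∈ kconf n K i k, krawtchoukWeight n K p h * ((h i).factorial : ℝ)) /
      ∑' h : {h : Fin n → ℕ // StrictMono h ∧ ∀ j, h j ≤ K}, krawtchoukWeight n K p h.1 := by
  have e : ∑ h ∈ kconf n K i k, krawtchoukWeight n K p h * ((h i).factorial : ℝ) =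
      ∑ h ∈ kconf n K i k, krawtchoukWeight n K p h * (k.factorial : ℝ) :=
    Finset.sum_congr rfl (fun h hh => by rw [(mem_kconf.1 hh).2.2])
  rw [kprob_eq, e, ← Finset.sum_mul]
  ring

lemma kprob_pos_iff (n K : ℕ) (p : ℝ) (hp0 : 0 < p) (hp1 : p < 1) (i : Fin n) (k : ℕ) :
    0 < krawtchoukProb n K p i k ↔ (kconf n K i k).Nonempty ∧
      0 < ∑' h : {h : Fin n → ℕ // StrictMono h ∧ ∀ j, h j ≤ K}, krawtchoukWeight n K p h.1 := by
  have hD : 0 ≤ ∑' h : {h : Fin n → ℕ // StrictMono h ∧ ∀ j, h j ≤ K},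
      krawtchoukWeight n K p h.1 := tsum_nonneg fun h => kW_nonneg n K p hp0 hp1 _
  rw [kprob_eq]
  constructor
  · intro h
    constructor
    · by_contra hne
      rw [Finset.not_nonempty_iff_eq_empty] at hne
      simp [hne] at h
    · rcases hD.lt_or_eq with h' | h'
      · exact h'
      · rw [← h'] at h; simp at h
  · rintro ⟨h1, h2⟩
    exact div_pos (Finset.sum_pos (fun h hh => kW_pos n K p hp0 hp1 h (mem_kconf.1 hh).1
      (mem_kconf.1 hh).2.1) h1) h2

/-- Every one-dimensional marginal of the Krawtchouk ensemble (parameters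
`K ≥ n ≥ 1`, `p ∈ (0,1)`) has a log-concave distribution (log-concavity inequality
for all `k`, no internal zeros); moreover its pmf is ultra-log-concave, i.e.
`k ↦ k!·P(h_i = k)` is log-concave. -/
theorem logConcave_ultraLogConcave_marginal_krawtchouk (n K : ℕ) (hn : 1 ≤ n)
    (hK : n ≤ K) (p : ℝ) (hp0 : 0 < p) (hp1 : p < 1) :
    ∀ i : Fin n,
      (∀ k : ℕ,
        krawtchoukProb n K p i k * krawtchoukProb n K p i (k + 2) ≤
          (krawtchoukProb n K p i (k + 1)) ^ 2) ∧
      (∀ k₁ k₂ k₃ : ℕ, k₁ ≤ k₂ → k₂ ≤ k₃ →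
        0 < krawtchoukProb n K p i k₁ → 0 < krawtchoukProb n K p i k₃ →
        0 < krawtchoukProb n K p i k₂) ∧
      (∀ k : ℕ,
        ((Nat.factorial k : ℝ) * krawtchoukProb n K p i k) *
          ((Nat.factorial (k + 2) : ℝ) * krawtchoukProb n K p i (k + 2)) ≤
        ((Nat.factorial (k + 1) : ℝ) * krawtchoukProb n K p i (k + 1)) ^ 2) := by
  intro i
  have hU : ∀ k : ℕ,
        ((Nat.factorial k : ℝ) * krawtchoukProb n K p i k) *
          ((Nat.factorial (k + 2) : ℝ) * krawtchoukProb n K p i (k + 2)) ≤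
        ((Nat.factorial (k + 1) : ℝ) * krawtchoukProb n K p i (k + 1)) ^ 2 := by
    intro k
    rw [kprob_fact, kprob_fact, kprob_fact, div_mul_div_comm, div_pow, ← pow_two]
    exact div_le_div_of_nonneg_right (main_ineq n K p hp0 hp1 i k) (sq_nonneg _)
  have hnn : ∀ k, 0 ≤ krawtchoukProb n K p i k := by
    intro k
    rw [kprob_eq]
    exact div_nonneg (Finset.sum_nonneg fun h _ => kW_nonneg n K p hp0 hp1 h)
      (tsum_nonneg fun h => kW_nonneg n K p hp0 hp1 _)
  refine ⟨?_, ?_, hU⟩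
  · intro k
    have h := hU k
    have hPP := mul_nonneg (hnn k) (hnn (k + 2))
    have hk : (0 : ℝ) < (k.factorial : ℝ) := by positivity
    have e2 : ((k + 2).factorial : ℝ) = (k + 2) * ((k + 1) * k.factorial) := by
      rw [Nat.factorial_succ, Nat.factorial_succ]; push_cast; ring
    have e1 : ((k + 1).factorial : ℝ) = (k + 1) * k.factorial := by
      rw [Nat.factorial_succ]; push_cast; ring
    rw [e1, e2] at h
    have hc : (0 : ℝ) < ((k + 1) * k.factorial) ^ 2 := by positivity
    refine le_of_mul_le_mul_left ?_ hc
    have hx : (0 : ℝ) ≤ (k + 1) * (k.factorial : ℝ) ^ 2 *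
      (krawtchoukProb n K p i k * krawtchoukProb n K p i (k + 2)) := by positivity
    linarith
  · intro k₁ k₂ k₃ h12 h23 hp1' hp3'
    obtain ⟨⟨x, hx⟩, hD⟩ := (kprob_pos_iff n K p hp0 hp1 i k₁).1 hp1'
    obtain ⟨⟨y, hy⟩, -⟩ := (kprob_pos_iff n K p hp0 hp1 i k₃).1 hp3'
    obtain ⟨hx1, hx2, hx3⟩ := mem_kconf.1 hx
    obtain ⟨hy1, hy2, hy3⟩ := mem_kconf.1 hy
    refine (kprob_pos_iff n K p hp0 hp1 i k₂).2 ⟨⟨fun j => if j < i then x j else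
      if j = i then k₂ else y j, mem_kconf.2 ⟨?_, ?_, ?_⟩⟩, hD⟩
    · intro a b hab
      have xab := hx1 hab
      have yab := hy1 hab
      have xa : a < i → x a < x i := fun h => hx1 h
      have yb : i < b → y i < y b := fun h => hy1 h
      simp only
      split_ifs <;> first | omega | (subst_vars; omega)
    · intro j
      have := hx2 j
      have := hy2 j
      have := hy2 i
      split_ifs <;> omega
    · simp
end
end

section
/- Let n ≥ 1 and let a, K be integers with K ≥ a ≥ n and K = a + n − 1. Under the Hahn ensemble, i.e. the probability measure on {h ∈ {0,1,…,K}^n : h_1 < ⋯ < h_n} with P(h) proportional to ∏_{1≤i<j≤n}(h_j − h_i)² · ∏_{j=1}^n binom(h_j + a − n, h_j) · binom(K + a − n − h_j, K − h_j), every one-dimensional marginal h_i has a log-concave distribution: P(h_i = k−1)·P(h_i = k+1) ≤ P(h_i = k)² for all k. -/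
open scoped BigOperators

noncomputable section

/-- Unnormalized Hahn weight of a configuration `h`:
`∏_{i<j} (h_j - h_i)² · ∏_j binom(h_j + a - n, h_j) · binom(K + a - n - h_j, K - h_j)`. -/
def hahnWeight (n a K : ℕ) (h : Fin n → ℕ) : ℝ :=
  (∏ i : Fin n, ∏ j : Fin n, if i < j then ((h j : ℝ) - (h i : ℝ)) ^ 2 else 1) *
    ∏ j : Fin n,
      (Nat.choose (h j + a - n) (h j) : ℝ) * (Nat.choose (K + a - n - h j) (K - h j) : ℝ)

/-- The Hahn-ensemble probability that the `i`-th point equals `k` (the configuration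
being constrained to `{0,…,K}`). -/
def hahnProb (n a K : ℕ) (i : Fin n) (k : ℕ) : ℝ :=
  (∑' h : {h : Fin n → ℕ // StrictMono h ∧ (∀ j, h j ≤ K) ∧ h i = k},
      hahnWeight n a K h.1) /
    ∑' h : {h : Fin n → ℕ // StrictMono h ∧ ∀ j, h j ≤ K}, hahnWeight n a K h.1

lemma choose_step (m x y : ℕ) (hxy : x ≤ y) :
    (Nat.choose (x + m) x : ℝ) * Nat.choose (y + 1 + m) (y + 1) ≤
      (Nat.choose (x + 1 + m) (x + 1) : ℝ) * Nat.choose (y + m) y := by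
  have key : ∀ z : ℕ, (Nat.choose (z + 1 + m) (z + 1) : ℝ) =
      Nat.choose (z + m) z * (((z : ℝ) + 1 + m) / (z + 1)) := by
    intro z
    have h := Nat.add_one_mul_choose_eq (z + m) z
    have e : z + 1 + m = z + m + 1 := by ring
    rw [e]
    have h2 : ((z + m + 1 : ℕ) : ℝ) * (Nat.choose (z + m) z : ℝ) =
      (Nat.choose (z + m + 1) (z + 1) : ℝ) * ((z + 1 : ℕ) : ℝ) := by exact_mod_cast h
    push_cast at h2
    have : (z : ℝ) + 1 ≠ 0 := by positivity
    field_simp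
    linarith
  rw [key x, key y]
  have h1 : ((y : ℝ) + 1 + m) / (y + 1) ≤ ((x : ℝ) + 1 + m) / (x + 1) := by
    have : (x : ℝ) ≤ y := by exact_mod_cast hxy
    have hm : (0 : ℝ) ≤ m := by positivity
    rw [div_le_div_iff₀ (by positivity) (by positivity)]
    nlinarith [mul_le_mul_of_nonneg_left this hm]
  have h2 : (0 : ℝ) ≤ Nat.choose (x + m) x * Nat.choose (y + m) y := by positivity
  nlinarith [mul_le_mul_of_nonneg_left h1 h2]

lemma single_step (n a K x y : ℕ) (ha : n ≤ a) (hx : x ≤ K) (hy : y ≤ K) :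
    ((Nat.choose (x + a - n) x : ℝ) * (Nat.choose (K + a - n - x) (K - x) : ℝ)) *
    ((Nat.choose (y + a - n) y : ℝ) * (Nat.choose (K + a - n - y) (K - y) : ℝ)) ≤
    ((Nat.choose (min (x+1) y + a - n) (min (x+1) y) : ℝ) *
      (Nat.choose (K + a - n - min (x+1) y) (K - min (x+1) y) : ℝ)) *
    ((Nat.choose (max x (y-1) + a - n) (max x (y-1)) : ℝ) *
      (Nat.choose (K + a - n - max x (y-1)) (K - max x (y-1)) : ℝ)) := by
  obtain ⟨m, rfl⟩ := Nat.exists_eq_add_of_le ha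
  rcases le_or_gt y (x+1) with h | h
  · rw [min_eq_right h, max_eq_left (by omega)]
    exact le_of_eq (mul_comm _ _)
  · rw [min_eq_left h.le, max_eq_right (by omega)]
    have e : ∀ z, z + (n + m) - n = z + m := by intro z; omega
    have e' : ∀ z, z ≤ K → K + (n + m) - n - z = (K - z) + m := by intro z hz; omega
    rw [e' _ hx, e' _ hy, e' (x+1) (by omega), e' (y-1) (by omega), e, e, e, e]
    have h1 := choose_step m x (y-1) (by omega)
    have h2 := choose_step m (K-y) (K-(x+1)) (by omega)
    rw [show y - 1 + 1 = y by omega] at h1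
    rw [show K - (x+1) + 1 = K - x by omega, show K - y + 1 = K - (y-1) by omega] at h2
    have := mul_le_mul h1 h2 (by positivity) (by positivity)
    linarith

lemma pair_step (p q r s : ℕ) (h1 : p < q) (h2 : r < s) :
    ((q : ℝ) - p) ^ 2 * ((s : ℝ) - r) ^ 2 ≤
    (((min (q+1) s : ℕ) : ℝ) - (min (p+1) r : ℕ)) ^ 2 *
    (((max q (s-1) : ℕ) : ℝ) - (max p (r-1) : ℕ)) ^ 2 := by
  have g1 : (p : ℝ) + 1 ≤ q := by exact_mod_cast h1
  have g2 : (r : ℝ) + 1 ≤ s := by exact_mod_cast h2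
  rw [← mul_pow, ← mul_pow]
  apply pow_le_pow_left₀ (mul_nonneg (by linarith) (by linarith))
  rcases le_or_gt s (q+1) with h | h <;> rcases le_or_gt r (p+1) with h' | h'
  · rw [min_eq_right h, max_eq_left (by omega), min_eq_right h', max_eq_left (by omega)]
    linarith
  · rw [min_eq_right h, max_eq_left (by omega), min_eq_left h'.le, max_eq_right (by omega)]
    have k1 : (s : ℝ) ≤ q + 1 := by exact_mod_cast h
    have k2 : (p : ℝ) + 1 < r := by exact_mod_cast h'
    rw [Nat.cast_sub (by omega)]
    push_cast
    nlinarith [mul_nonneg (sub_nonneg.2 k1) (sub_nonneg.2 k2.le)]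
  · rw [min_eq_left h.le, max_eq_right (by omega), min_eq_right h', max_eq_left (by omega)]
    have k1 : (q : ℝ) + 1 < s := by exact_mod_cast h
    have k2 : (r : ℝ) ≤ p + 1 := by exact_mod_cast h'
    rw [Nat.cast_sub (by omega)]
    push_cast
    nlinarith [mul_nonneg (sub_nonneg.2 k1.le) (sub_nonneg.2 k2)]
  · rw [min_eq_left h.le, max_eq_right (by omega), min_eq_left h'.le, max_eq_right (by omega)]
    rw [Nat.cast_sub (by omega), Nat.cast_sub (by omega)]
    push_cast
    linarith

lemma weight_step (n a K : ℕ) (ha : n ≤ a) (f g : Fin n → ℕ) (hf : StrictMono f)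
    (hg : StrictMono g) (hfK : ∀ j, f j ≤ K) (hgK : ∀ j, g j ≤ K) :
    hahnWeight n a K f * hahnWeight n a K g ≤
      hahnWeight n a K (fun j => min (f j + 1) (g j)) *
      hahnWeight n a K (fun j => max (f j) (g j - 1)) := by
  unfold hahnWeight
  refine (mul_mul_mul_comm _ _ _ _).trans_le (le_trans ?_ (mul_mul_mul_comm _ _ _ _).le)
  have hp : ∀ i j : Fin n, ∀ u : Fin n → ℕ,
      (0 : ℝ) ≤ if i < j then ((u j : ℝ) - (u i : ℝ)) ^ 2 else 1 := by
    intro i j u; split_ifs <;> positivity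
  apply mul_le_mul <;> simp only [← Finset.prod_mul_distrib]
  · refine Finset.prod_le_prod (fun i _ => Finset.prod_nonneg fun j _ =>
      mul_nonneg (hp i j f) (hp i j g)) fun i _ => ?_
    refine Finset.prod_le_prod (fun j _ => mul_nonneg (hp i j f) (hp i j g)) fun j _ => ?_
    split_ifs with hij
    · exact pair_step _ _ _ _ (hf hij) (hg hij)
    · exact le_rfl
  · exact Finset.prod_le_prod (fun j _ => by positivity) fun j _ =>
      single_step n a K _ _ ha (hfK j) (hgK j)
  · exact Finset.prod_nonneg fun j _ => by positivity
  · refine Finset.prod_nonneg fun i _ => Finset.prod_nonneg fun j _ => ?_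
    split_ifs <;> positivity

lemma weight_nonneg (n a K : ℕ) (f : Fin n → ℕ) : 0 ≤ hahnWeight n a K f := by
  unfold hahnWeight
  refine mul_nonneg (Finset.prod_nonneg fun i _ => Finset.prod_nonneg fun j _ => ?_)
    (Finset.prod_nonneg fun j _ => by positivity)
  split_ifs <;> positivity

lemma weight_pos (n a K : ℕ) (ha : n ≤ a) (f : Fin n → ℕ) (hf : StrictMono f)
    (hfK : ∀ j, f j ≤ K) : 0 < hahnWeight n a K f := by
  unfold hahnWeight
  refine mul_pos (Finset.prod_pos fun i _ => Finset.prod_pos fun j _ => ?_)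
    (Finset.prod_pos fun j _ => ?_)
  · split_ifs with h
    · have : (f i : ℝ) < f j := by exact_mod_cast hf h
      have : (0 : ℝ) < f j - f i := by linarith
      positivity
    · exact one_pos
  · have := hfK j
    exact mul_pos (by exact_mod_cast Nat.choose_pos (by omega))
      (by exact_mod_cast Nat.choose_pos (by omega))

/-- admissible configurations with i-th point k -/
def confSet (n K : ℕ) (i : Fin n) (k : ℕ) : Set (Fin n → ℕ) :=
  {h | StrictMono h ∧ (∀ j, h j ≤ K) ∧ h i = k}

/-- extended weight -/
def extW (n a K : ℕ) (i : Fin n) (k : ℕ) : (Fin n → ℕ) → ℝ :=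
  (confSet n K i k).indicator (hahnWeight n a K)

lemma extW_nonneg (n a K : ℕ) (i : Fin n) (k : ℕ) (x) : 0 ≤ extW n a K i k x :=
  Set.indicator_nonneg (fun _ _ => weight_nonneg _ _ _ _) _

/-- shift of the extended weight by one -/
def shW (n a K : ℕ) (i : Fin n) (k : ℕ) : (Fin n → ℕ) → ℝ :=
  Function.extend (fun f : Fin n → ℕ => fun j => f j + 1) (extW n a K i k) 0

lemma shift_inj (n : ℕ) : Function.Injective (fun f : Fin n → ℕ => fun j => f j + 1) := by
  intro f g h
  funext j
  have := congrFun h j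
  simpa using this

lemma shW_shift (n a K : ℕ) (i : Fin n) (k : ℕ) (f : Fin n → ℕ) :
    shW n a K i k (fun j => f j + 1) = extW n a K i k f :=
  (shift_inj n).extend_apply _ _ _

lemma shW_cases (n a K : ℕ) (i : Fin n) (k : ℕ) (x : Fin n → ℕ) :
    shW n a K i k x = 0 ∨ ∃ f ∈ confSet n K i k, x = (fun j => f j + 1) ∧
      shW n a K i k x = hahnWeight n a K f := by
  by_cases h : ∃ f : Fin n → ℕ, (fun j => f j + 1) = x
  · obtain ⟨f, rfl⟩ := h
    rw [shW_shift]
    by_cases hf : f ∈ confSet n K i k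
    · right; exact ⟨f, hf, rfl, by simp [extW, hf]⟩
    · left; simp [extW, hf]
  · left; exact Function.extend_apply' _ _ _ h

lemma shW_nonneg (n a K : ℕ) (i : Fin n) (k : ℕ) (x) : 0 ≤ shW n a K i k x := by
  rcases shW_cases n a K i k x with h | ⟨f, _, _, h⟩
  · rw [h]
  · rw [h]; exact weight_nonneg _ _ _ _

/-- bounding box -/
def bigBox (n K : ℕ) : Finset (Fin n → ℕ) := Fintype.piFinset fun _ => Finset.range (K + 2)

lemma extW_zero (n a K : ℕ) (i : Fin n) (k : ℕ) (x) (hx : x ∉ bigBox n K) :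
    extW n a K i k x = 0 := by
  apply Set.indicator_of_notMem
  intro h
  apply hx
  simp only [bigBox, Fintype.mem_piFinset, Finset.mem_range]
  intro j
  have := h.2.1 j
  omega

lemma shW_zero (n a K : ℕ) (i : Fin n) (k : ℕ) (x) (hx : x ∉ bigBox n K) :
    shW n a K i k x = 0 := by
  rcases shW_cases n a K i k x with h | ⟨f, hf, rfl, h⟩
  · exact h
  · exfalso
    apply hx
    simp only [bigBox, Fintype.mem_piFinset, Finset.mem_range]
    intro j
    have := hf.2.1 j
    omega

/-- unnormalised marginal -/
def margin (n a K : ℕ) (i : Fin n) (k : ℕ) : ℝ := ∑' x, extW n a K i k x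

lemma margin_sh (n a K : ℕ) (i : Fin n) (k : ℕ) :
    ∑' x, shW n a K i k x = margin n a K i k := tsum_extend_zero (shift_inj n) _

lemma ext_summable (n a K : ℕ) (i : Fin n) (k : ℕ) : Summable (extW n a K i k) :=
  summable_of_ne_finset_zero (s := bigBox n K) fun x hx => extW_zero _ _ _ _ _ x hx

lemma sh_summable (n a K : ℕ) (i : Fin n) (k : ℕ) : Summable (shW n a K i k) :=
  summable_of_ne_finset_zero (s := bigBox n K) fun x hx => shW_zero _ _ _ _ _ x hx

lemma margin_step (n a K : ℕ) (ha : n ≤ a) (i : Fin n) (k : ℕ) :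
    margin n a K i k * margin n a K i (k + 2) ≤ margin n a K i (k + 1) ^ 2 := by
  have h := four_functions_theorem (α := Fin n → ℕ) (shW n a K i k) (extW n a K i (k+2))
    (extW n a K i (k+1)) (shW n a K i (k+1)) (fun x => shW_nonneg _ _ _ _ _ x)
    (fun x => extW_nonneg _ _ _ _ _ x) (fun x => extW_nonneg _ _ _ _ _ x)
    (fun x => shW_nonneg _ _ _ _ _ x) ?_ (bigBox n K) (bigBox n K)
  · rw [← tsum_eq_sum (L := SummationFilter.unconditional _) (fun x hx => shW_zero _ _ _ _ _ x hx),
      ← tsum_eq_sum (L := SummationFilter.unconditional _) (fun x hx => extW_zero _ _ _ _ _ x hx), margin_sh] at h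
    refine h.trans ?_
    rw [sq]
    refine mul_le_mul ((ext_summable _ _ _ _ _).sum_le_tsum _ fun x _ => extW_nonneg _ _ _ _ _ x)
      ?_ (Finset.sum_nonneg fun x _ => shW_nonneg _ _ _ _ _ x)
      (tsum_nonneg fun x => extW_nonneg _ _ _ _ _ x)
    rw [← margin_sh]
    exact (sh_summable _ _ _ _ _).sum_le_tsum _ fun x _ => shW_nonneg _ _ _ _ _ x
  · intro x g
    have hnn : 0 ≤ extW n a K i (k+1) (x ⊓ g) * shW n a K i (k+1) (x ⊔ g) :=
      mul_nonneg (extW_nonneg _ _ _ _ _ _) (shW_nonneg _ _ _ _ _ _)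
    rcases shW_cases n a K i k x with h | ⟨f, hf, rfl, h⟩
    · rw [h, zero_mul]; exact hnn
    by_cases hg : g ∈ confSet n K i (k+2)
    swap
    · rw [show extW n a K i (k+2) g = 0 from Set.indicator_of_notMem hg _, mul_zero]; exact hnn
    rw [h, show extW n a K i (k+2) g = hahnWeight n a K g from Set.indicator_of_mem hg _]
    have e1 : (fun j => f j + 1) ⊓ g = fun j => min (f j + 1) (g j) := rfl
    have e2 : (fun j => f j + 1) ⊔ g = fun j => (max (f j) (g j - 1)) + 1 := by
      funext j
      change max (f j + 1) (g j) = _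
      omega
    obtain ⟨hf1, hf2, hf3⟩ := hf
    obtain ⟨hg1, hg2, hg3⟩ := hg
    have m1 : (fun j => min (f j + 1) (g j)) ∈ confSet n K i (k+1) := by
      refine ⟨fun p q hpq => ?_, fun j => ?_, ?_⟩
      · have := hf1 hpq
        have := hg1 hpq
        dsimp only
        omega
      · have := hg2 j
        dsimp only
        omega
      · dsimp only
        omega
    have m2 : (fun j => max (f j) (g j - 1)) ∈ confSet n K i (k+1) := by
      refine ⟨fun p q hpq => ?_, fun j => ?_, ?_⟩
      · have := hf1 hpq
        have := hg1 hpq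
        dsimp only
        omega
      · have := hg2 j
        have := hf2 j
        dsimp only
        omega
      · dsimp only
        omega
    rw [e1, e2, shW_shift]
    unfold extW
    rw [Set.indicator_of_mem m1, Set.indicator_of_mem m2]
    exact weight_step n a K ha f g hf1 hg1 hf2 hg2

lemma margin_pos_iff (n a K : ℕ) (ha : n ≤ a) (i : Fin n) (k : ℕ) :
    0 < margin n a K i k ↔ (confSet n K i k).Nonempty := by
  constructor
  · intro h
    by_contra hne
    rw [Set.not_nonempty_iff_eq_empty] at hne
    simp [margin, extW, hne] at h
  · rintro ⟨f, hf⟩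
    refine (ext_summable _ _ _ _ _).tsum_pos (fun x => extW_nonneg _ _ _ _ _ x) f ?_
    rw [extW, Set.indicator_of_mem hf]
    exact weight_pos n a K ha f hf.1 hf.2.1

lemma prob_eq (n a K : ℕ) (i : Fin n) (k : ℕ) : hahnProb n a K i k = margin n a K i k /
    ∑' h : {h : Fin n → ℕ // StrictMono h ∧ ∀ j, h j ≤ K}, hahnWeight n a K h.1 := by
  unfold hahnProb
  congr 1
  exact tsum_subtype (confSet n K i k) (hahnWeight n a K)

/-- Every one-dimensional marginal of the Hahn ensemble (integer parameters
`K ≥ a ≥ n ≥ 1` with `K = a + n − 1`) has a log-concave distribution: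
the pmf satisfies the log-concavity inequality for all `k` and has no internal
zeros. -/
theorem logConcave_marginal_hahn (n a K : ℕ) (hn : 1 ≤ n) (ha : n ≤ a) (haK : a ≤ K)
    (hK : K = a + n - 1) :
    ∀ i : Fin n,
      (∀ k : ℕ,
        hahnProb n a K i k * hahnProb n a K i (k + 2) ≤ (hahnProb n a K i (k + 1)) ^ 2) ∧
      (∀ k₁ k₂ k₃ : ℕ, k₁ ≤ k₂ → k₂ ≤ k₃ →
        0 < hahnProb n a K i k₁ → 0 < hahnProb n a K i k₃ →
        0 < hahnProb n a K i k₂) := by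
  intro i
  have hZ : 0 ≤ ∑' h : {h : Fin n → ℕ // StrictMono h ∧ ∀ j, h j ≤ K}, hahnWeight n a K h.1 :=
    tsum_nonneg fun h => weight_nonneg _ _ _ _
  simp only [prob_eq]
  generalize (∑' h : {h : Fin n → ℕ // StrictMono h ∧ ∀ j, h j ≤ K}, hahnWeight n a K h.1) = Z
    at hZ ⊢
  refine ⟨fun k => ?_, fun k₁ k₂ k₃ h12 h23 h1 h3 => ?_⟩
  · rw [div_mul_div_comm, div_pow, ← sq]
    exact div_le_div_of_nonneg_right (margin_step n a K ha i k) (sq_nonneg Z)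
  · have hZ' : 0 < Z := by
      rcases hZ.eq_or_lt with h | h
      · rw [← h, div_zero] at h1
        exact absurd h1 (lt_irrefl _)
      · exact h
    rw [div_pos_iff_of_pos_right hZ', margin_pos_iff n a K ha] at *
    obtain ⟨f, hf1, hf2, hf3⟩ := h1
    obtain ⟨g, hg1, hg2, hg3⟩ := h3
    refine ⟨fun j => max (f j) (g j - (k₃ - k₂)), fun p q hpq => ?_, fun j => ?_, ?_⟩
    · have := hf1 hpq
      have := hg1 hpq
      dsimp only
      omega
    · have := hg2 j
      have := hf2 j
      dsimp only
      omega
    · dsimp only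
      omega
end
end
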